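/- Let n ≥ 1, let 1 < r ≤ r₀ < ∞, let 1 < p < ∞, and let N : [1,∞) → (0,∞) be increasing. Then there exists a constant C > 0 such that ‖f‖_{M^{r₀}_r} ≤ C‖g‖_{M^{r₀}_r} for every pair (f,g) ∈ F(p,N), where the Morrey norm is ‖h‖_{M^{r₀}_r} := sup_{x∈ℝⁿ, R>0} |B(x,R)|^{1/r₀ − 1/r} (∫_{B(x,R)} |h(y)|^r dy)^{1/r}. -/

import Mathlib

open MeasureTheory ENNReal NNReal Filter Topology

noncomputable section

/-- Euclidean space ℝⁿ. -/
abbrev Eucl (n : ℕ) := EuclideanSpace ℝ (Fin n)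

/-- The axes-parallel closed cube with center `x` and radius `r`. -/
def cubeSet {n : ℕ} (x : Eucl n) (r : ℝ) : Set (Eucl n) :=
  {y | ∀ i, |x i - y i| ≤ r}

/-- The Muckenhoupt `A_p` characteristic
`[w]_{A_p} = sup_Q (|Q|⁻¹∫_Q w) (|Q|⁻¹∫_Q w^{-1/(p-1)})^{p-1}`. -/
def apConst (n : ℕ) (p : ℝ) (w : Eucl n → ℝ≥0∞) : ℝ≥0∞ :=
  ⨆ (x : Eucl n) (r : ℝ) (_ : 0 < r),
    ((volume (cubeSet x r))⁻¹ * ∫⁻ y in cubeSet x r, w y) *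
      ((volume (cubeSet x r))⁻¹ * ∫⁻ y in cubeSet x r, w y ^ (-(1/(p-1)))) ^ (p-1)

/-- A weight: measurable, positive and finite a.e. -/
def IsWeight {n : ℕ} (w : Eucl n → ℝ≥0∞) : Prop :=
  Measurable w ∧ ∀ᵐ x ∂(volume : Measure (Eucl n)), 0 < w x ∧ w x < ⊤

/-- `w ∈ A_p`. -/
def MemAp (n : ℕ) (p : ℝ) (w : Eucl n → ℝ≥0∞) : Prop :=
  IsWeight w ∧ apConst n p w < ⊤

/-- The weighted Lebesgue norm, for an `ℝ≥0∞`-valued function. -/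
def wLpE (n : ℕ) (p : ℝ) (w : Eucl n → ℝ≥0∞) (F : Eucl n → ℝ≥0∞) : ℝ≥0∞ :=
  (∫⁻ x, F x ^ p * w x) ^ (1/p)

/-- The weighted Lebesgue norm `‖f‖_{L^p(w)} = (∫ |f|^p w)^{1/p}`. -/
def wLp (n : ℕ) (p : ℝ) (w : Eucl n → ℝ≥0∞) (f : Eucl n → ℝ) : ℝ≥0∞ :=
  wLpE n p w (fun x => (‖f x‖₊ : ℝ≥0∞))

/-- The extrapolation family `F(p,N)`: pairs of measurable functions `(f,g)` with
`‖f‖_{L^p(w)} ≤ N([w]_{A_p}) ‖g‖_{L^p(w)}` for every `w ∈ A_p`. -/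
def memF (n : ℕ) (p : ℝ) (N : ℝ → ℝ) (f g : Eucl n → ℝ) : Prop :=
  Measurable f ∧ Measurable g ∧
    ∀ w : Eucl n → ℝ≥0∞, MemAp n p w →
      wLp n p w f ≤ ENNReal.ofReal (N ((apConst n p w).toReal)) * wLp n p w g

/-- The Morrey norm, for an `ℝ≥0∞`-valued function. -/
def morreyE (n : ℕ) (r r0 : ℝ) (F : Eucl n → ℝ≥0∞) : ℝ≥0∞ :=
  ⨆ (x : Eucl n) (R : ℝ) (_ : 0 < R),
    volume (Metric.ball x R) ^ (1/r0 - 1/r) *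
      (∫⁻ y in Metric.ball x R, F y ^ r) ^ (1/r)

/-- The Morrey norm
`‖h‖_{M^{r₀}_r} = sup_{x,R>0} |B(x,R)|^{1/r₀-1/r} (∫_{B(x,R)} |h|^r)^{1/r}`. -/
def morreyNorm (n : ℕ) (r r0 : ℝ) (h : Eucl n → ℝ) : ℝ≥0∞ :=
  morreyE n r r0 (fun x => (‖h x‖₊ : ℝ≥0∞))

/-- uncentered maximal function over open balls -/
def HLM {n : ℕ} (h : Eucl n → ℝ≥0∞) (x : Eucl n) : ℝ≥0∞ :=
  ⨆ (c : Eucl n) (ρ : ℝ) (_ : x ∈ Metric.ball c ρ),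
    (volume (Metric.ball c ρ))⁻¹ * ∫⁻ y in Metric.ball c ρ, h y

lemma vol_ball_scale {n : ℕ} (c c' : Eucl n) {k : ℝ} (hk : 0 < k) (ρ : ℝ) :
    volume (Metric.ball c (k * ρ)) = ENNReal.ofReal (k ^ n) * volume (Metric.ball c' ρ) := by
  rw [Measure.addHaar_ball_mul_of_pos volume c hk, Measure.addHaar_ball_center volume c']
  simp

lemma vol_ball_ne_zero {n : ℕ} (c : Eucl n) {ρ : ℝ} (h : 0 < ρ) :
    volume (Metric.ball c ρ) ≠ 0 := (Metric.measure_ball_pos volume c h).ne'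

lemma vol_ball_ne_top {n : ℕ} (c : Eucl n) (ρ : ℝ) :
    volume (Metric.ball c ρ) ≠ ⊤ := measure_ball_lt_top.ne

lemma avg_le_HLM {n : ℕ} (h : Eucl n → ℝ≥0∞) {x c : Eucl n} {ρ : ℝ} (hx : x ∈ Metric.ball c ρ) :
    (volume (Metric.ball c ρ))⁻¹ * ∫⁻ y in Metric.ball c ρ, h y ≤ HLM h x := by
  unfold HLM
  exact le_iSup_of_le c (le_iSup_of_le ρ (le_iSup_of_le hx le_rfl))

lemma int_le_HLM {n : ℕ} (h : Eucl n → ℝ≥0∞) {x c : Eucl n} {ρ : ℝ} (hx : x ∈ Metric.ball c ρ) :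
    ∫⁻ y in Metric.ball c ρ, h y ≤ volume (Metric.ball c ρ) * HLM h x := by
  have hρ : 0 < ρ := Metric.pos_of_mem_ball hx
  have := avg_le_HLM h hx
  rwa [ENNReal.inv_mul_le_iff (vol_ball_ne_zero c hρ) (vol_ball_ne_top c ρ)] at this

lemma HLM_le {n : ℕ} (h : Eucl n → ℝ≥0∞) (x : Eucl n) (T : ℝ≥0∞)
    (H : ∀ c ρ, x ∈ Metric.ball c ρ → ∫⁻ y in Metric.ball c ρ, h y ≤ volume (Metric.ball c ρ) * T) :
    HLM h x ≤ T := by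
  unfold HLM
  refine iSup_le fun c => iSup_le fun ρ => iSup_le fun hx => ?_
  rw [ENNReal.inv_mul_le_iff (vol_ball_ne_zero c (Metric.pos_of_mem_ball hx)) (vol_ball_ne_top c ρ)]
  exact H c ρ hx

lemma lt_HLM {n : ℕ} {h : Eucl n → ℝ≥0∞} {x : Eucl n} {l : ℝ≥0∞} (H : l < HLM h x) :
    ∃ c ρ, x ∈ Metric.ball c ρ ∧
      l < (volume (Metric.ball c ρ))⁻¹ * ∫⁻ y in Metric.ball c ρ, h y := by
  unfold HLM at H
  simp only [lt_iSup_iff] at H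
  obtain ⟨c, ρ, hx, H⟩ := H
  exact ⟨c, ρ, hx, H⟩

lemma HLM_measurable {n : ℕ} (h : Eucl n → ℝ≥0∞) : Measurable (HLM h) := by
  apply measurable_of_Ioi
  intro l
  apply IsOpen.measurableSet
  rw [isOpen_iff_forall_mem_open]
  intro x hx
  obtain ⟨c, ρ, hxc, hl⟩ := lt_HLM (Set.mem_Ioi.1 hx)
  exact ⟨Metric.ball c ρ, fun y hy => Set.mem_Ioi.2 (hl.trans_le (avg_le_HLM h hy)),
    Metric.isOpen_ball, hxc⟩

lemma HLM_mono {n : ℕ} {h k : Eucl n → ℝ≥0∞} (H : ∀ x, h x ≤ k x) (x : Eucl n) :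
    HLM h x ≤ HLM k x := by
  refine HLM_le h x _ fun c ρ hx => ?_
  exact (lintegral_mono H).trans (int_le_HLM k hx)

lemma HLM_add_le {n : ℕ} {h k : Eucl n → ℝ≥0∞} (hm : Measurable h) (x : Eucl n) :
    HLM (fun y => h y + k y) x ≤ HLM h x + HLM k x := by
  refine HLM_le _ x _ fun c ρ hx => ?_
  rw [lintegral_add_left hm, mul_add]
  exact add_le_add (int_le_HLM h hx) (int_le_HLM k hx)

lemma HLM_const_le {n : ℕ} {h : Eucl n → ℝ≥0∞} (T : ℝ≥0∞) (H : ∀ x, h x ≤ T) (x : Eucl n) :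
    HLM h x ≤ T := by
  refine HLM_le _ x _ fun c ρ hx => ?_
  refine (lintegral_mono H).trans ?_
  simp [mul_comm]

lemma HLM_weak {n : ℕ} (hn : 1 ≤ n) (h : Eucl n → ℝ≥0∞) (l : ℝ≥0∞) :
    volume {x | l < HLM h x} * l ≤ ENNReal.ofReal (5 ^ n) * ∫⁻ y, h y := by
  rcases eq_or_ne l 0 with rfl | hl0
  · simp
  rcases eq_or_ne l ⊤ with rfl | hlt
  · simp
  by_cases hI : ∫⁻ y, h y = ⊤
  · rw [hI, ENNReal.mul_top (by simp)]; exact le_top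
  set t : Set (Eucl n × ℝ) := {a | 0 < a.2 ∧
    l < (volume (Metric.ball a.1 a.2))⁻¹ * ∫⁻ y in Metric.ball a.1 a.2, h y} with ht
  have key : ∀ a ∈ t, volume (Metric.ball a.1 a.2) * l ≤ ∫⁻ y in Metric.ball a.1 a.2, h y := by
    intro a ha
    have := ha.2.le
    rwa [← ENNReal.div_eq_inv_mul, ENNReal.le_div_iff_mul_le (Or.inl (vol_ball_ne_zero _ ha.1))
      (Or.inl (vol_ball_ne_top _ _)), mul_comm] at this
  have hR : ∃ R : ℝ, ∀ a ∈ t, a.2 ≤ R := by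
    set κ := volume (Metric.ball (0 : Eucl n) 1)
    have hκ0 : κ ≠ 0 := vol_ball_ne_zero _ one_pos
    refine ⟨max 1 ((∫⁻ y, h y) / (κ * l)).toReal, fun a ha => ?_⟩
    have h1 := (key a ha).trans (setLIntegral_le_lintegral _ _)
    have h2 := vol_ball_scale a.1 (0 : Eucl n) ha.1 1
    rw [mul_one] at h2
    rw [h2, mul_assoc] at h1
    rw [← ENNReal.le_div_iff_mul_le (Or.inl (mul_ne_zero hκ0 hl0))
      (Or.inl (ENNReal.mul_ne_top (vol_ball_ne_top _ _) hlt))] at h1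
    rcases le_total a.2 1 with h3 | h3
    · exact h3.trans (le_max_left _ _)
    · refine le_trans ?_ (le_max_right _ _)
      refine (le_self_pow₀ h3 (by omega : n ≠ 0)).trans ?_
      rw [ENNReal.ofReal_le_iff_le_toReal] at h1
      · exact h1
      · exact (ENNReal.div_lt_top hI (mul_ne_zero hκ0 hl0)).ne
  obtain ⟨R, hR⟩ := hR
  obtain ⟨u, hut, hdis, hcov⟩ := Vitali.exists_disjoint_subfamily_covering_enlargement_ball t
    (fun a => a.1) (fun a => a.2) R hR 5 (by norm_num)
  have hcount : u.Countable := hdis.countable_of_isOpen (fun a _ => Metric.isOpen_ball)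
    (fun a ha => Metric.nonempty_ball.2 (hut ha).1)
  have hsub : {x | l < HLM h x} ⊆ ⋃ a ∈ u, Metric.ball a.1 (5 * a.2) := by
    intro x hx
    obtain ⟨c, ρ, hxc, hl⟩ := lt_HLM hx
    obtain ⟨b, hb, hs⟩ := hcov (c, ρ) ⟨Metric.pos_of_mem_ball hxc, hl⟩
    exact Set.mem_biUnion hb (hs hxc)
  calc volume {x | l < HLM h x} * l
      ≤ (∑' a : u, volume (Metric.ball a.1.1 (5 * a.1.2))) * l := by
        gcongr
        exact (measure_mono hsub).trans (measure_biUnion_le _ hcount _)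
    _ = ∑' a : u, ENNReal.ofReal (5 ^ n) * (volume (Metric.ball a.1.1 a.1.2) * l) := by
        rw [← ENNReal.tsum_mul_right]
        congr 1; ext a
        rw [vol_ball_scale a.1.1 a.1.1 (by norm_num), mul_assoc]
    _ ≤ ∑' a : u, ENNReal.ofReal (5 ^ n) * ∫⁻ y in Metric.ball a.1.1 a.1.2, h y := by
        gcongr with a
        exact key a.1 (hut a.2)
    _ = ENNReal.ofReal (5 ^ n) * ∫⁻ y in ⋃ a ∈ u, Metric.ball a.1 a.2, h y := by
        rw [ENNReal.tsum_mul_left, lintegral_biUnion hcount (fun a _ => measurableSet_ball) hdis]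
    _ ≤ _ := by gcongr; exact Measure.restrict_le_self

lemma HLM_weak' {n : ℕ} (hn : 1 ≤ n) {h : Eucl n → ℝ≥0∞} (hm : Measurable h) (l : ℝ≥0∞) :
    volume {x | l < HLM h x} * (l / 2) ≤
      ENNReal.ofReal (5 ^ n) * ∫⁻ y in {y | l / 2 < h y}, h y := by
  rcases eq_or_ne l ⊤ with rfl | hlt
  · simp
  have hS : MeasurableSet {y | l / 2 < h y} := measurableSet_lt measurable_const hm
  have h1 : ∀ x, h x ≤ Set.indicator {y | l / 2 < h y} h x + l / 2 := by
    intro x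
    by_cases hx : l / 2 < h x
    · rw [Set.indicator_of_mem (by exact hx)]; exact le_self_add
    · exact (not_lt.1 hx).trans le_add_self
  have h2 : ∀ x, HLM h x ≤ HLM (Set.indicator {y | l / 2 < h y} h) x + l / 2 := by
    intro x
    refine (HLM_mono h1 x).trans ((HLM_add_le (hm.indicator hS) x).trans ?_)
    gcongr
    exact HLM_const_le _ (fun _ => le_rfl) x
  rw [← lintegral_indicator hS]
  refine le_trans ?_ (HLM_weak hn _ (l / 2))
  refine mul_le_mul' (measure_mono fun x hx => ?_) le_rfl
  by_contra hcon
  have := (h2 x).trans (add_le_add (not_lt.1 hcon) le_rfl)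
  rw [ENNReal.add_halves] at this
  exact absurd hx (not_lt.2 this)

lemma rpow_layer_ofReal {q : ℝ} (hq : 0 < q) {b : ℝ} (hb : 0 ≤ b) :
    ∫⁻ l in Set.Ioi (0 : ℝ), (if ENNReal.ofReal l < ENNReal.ofReal b then
      ENNReal.ofReal (q * l ^ (q - 1)) else 0) = ENNReal.ofReal b ^ q := by
  have h1 : ∫⁻ l in Set.Ioi (0 : ℝ), (if ENNReal.ofReal l < ENNReal.ofReal b then
      ENNReal.ofReal (q * l ^ (q - 1)) else 0) =
      ∫⁻ l in Set.Ioo (0 : ℝ) b, ENNReal.ofReal (q * l ^ (q - 1)) := by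
    rw [← lintegral_indicator measurableSet_Ioi, ← lintegral_indicator measurableSet_Ioo]
    congr 1; ext l
    by_cases hl : 0 < l
    · by_cases hlb : l < b
      · rw [Set.indicator_of_mem (by exact hl), Set.indicator_of_mem (by exact ⟨hl, hlb⟩),
          if_pos ((ENNReal.ofReal_lt_ofReal_iff (hl.trans hlb)).2 hlb)]
      · rw [Set.indicator_of_mem (by exact hl), Set.indicator_of_notMem (by simp [hlb]),
          if_neg (not_lt.2 (ENNReal.ofReal_le_ofReal (not_lt.1 hlb)))]
    · rw [Set.indicator_of_notMem (by simpa using hl), Set.indicator_of_notMem (by simp [hl])]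
  have hint : IntervalIntegrable (fun l : ℝ => q * l ^ (q - 1)) volume 0 b :=
    (intervalIntegral.intervalIntegrable_rpow' (by linarith)).const_mul q
  rw [h1, ← ofReal_integral_eq_lintegral_ofReal]
  · rw [← integral_Ioc_eq_integral_Ioo, ← intervalIntegral.integral_of_le hb,
      intervalIntegral.integral_const_mul, integral_rpow (Or.inl (by linarith)),
      ENNReal.ofReal_rpow_of_nonneg hb hq.le]
    congr 1
    rw [sub_add_cancel, Real.zero_rpow hq.ne']
    field_simp
    ring
  · have := (intervalIntegrable_iff_integrableOn_Ioc_of_le hb).1 hint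
    exact this.mono_set Set.Ioo_subset_Ioc_self
  · filter_upwards [ae_restrict_mem measurableSet_Ioo] with l hl
    have := hl.1
    simp only [Pi.zero_apply]
    positivity

lemma rpow_layer {q : ℝ} (hq : 0 < q) (a : ℝ≥0∞) :
    ∫⁻ l in Set.Ioi (0 : ℝ), (if ENNReal.ofReal l < a then
      ENNReal.ofReal (q * l ^ (q - 1)) else 0) = a ^ q := by
  rcases eq_or_ne a ⊤ with rfl | ha
  · rw [ENNReal.top_rpow_of_pos hq]
    by_contra hcon
    set T := ∫⁻ l in Set.Ioi (0 : ℝ), (if ENNReal.ofReal l < ⊤ then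
      ENNReal.ofReal (q * l ^ (q - 1)) else 0) with hT
    have hT' : T ^ (1 / q) ≠ ⊤ := (ENNReal.rpow_lt_top_of_nonneg (by positivity) hcon).ne
    obtain ⟨k, hk⟩ := ENNReal.exists_nat_gt hT'
    have h1 : (ENNReal.ofReal k) ^ q ≤ T := by
      rw [← rpow_layer_ofReal hq (Nat.cast_nonneg k)]
      apply lintegral_mono
      intro l
      simp only [ENNReal.ofReal_lt_top, if_true]
      split_ifs <;> simp
    have h2 : T < (ENNReal.ofReal k) ^ q := by
      have := ENNReal.rpow_lt_rpow hk hq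
      rw [← ENNReal.rpow_mul, one_div, inv_mul_cancel₀ hq.ne', ENNReal.rpow_one] at this
      simpa using this
    exact absurd h1 (not_le.2 h2)
  · have := rpow_layer_ofReal hq (b := a.toReal) ENNReal.toReal_nonneg
    rwa [ENNReal.ofReal_toReal ha] at this

lemma lintegral_layer {α : Type*} [MeasurableSpace α] (μ : Measure α) [SFinite μ]
    {F : α → ℝ≥0∞} (hF : Measurable F) {q : ℝ} (hq : 0 < q) :
    ∫⁻ x, F x ^ q ∂μ =
      ∫⁻ l in Set.Ioi (0 : ℝ), ENNReal.ofReal (q * l ^ (q - 1)) * μ {x | ENNReal.ofReal l < F x} := by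
  simp_rw [← rpow_layer hq (F _)]
  rw [lintegral_lintegral_swap]
  · congr 1; ext l
    have : (fun x => if ENNReal.ofReal l < F x then ENNReal.ofReal (q * l ^ (q - 1)) else 0) =
      Set.indicator {x | ENNReal.ofReal l < F x} (fun _ => ENNReal.ofReal (q * l ^ (q - 1))) := by
      ext x; simp [Set.indicator]
    rw [this, lintegral_indicator (measurableSet_lt measurable_const hF)]
    simp
  · apply Measurable.aemeasurable
    refine Measurable.ite (measurableSet_lt ?_ ?_) ?_ measurable_const <;> fun_prop

lemma HLM_strong {n : ℕ} (hn : 1 ≤ n) {q : ℝ} (hq : 1 < q) :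
    ∃ C : ℝ≥0∞, C ≠ ⊤ ∧ ∀ h : Eucl n → ℝ≥0∞, Measurable h →
      ∫⁻ x, HLM h x ^ q ≤ C * ∫⁻ x, h x ^ q := by
  refine ⟨ENNReal.ofReal (2 * q / (q - 1) * 5 ^ n) * 2 ^ (q - 1),
    ENNReal.mul_ne_top (by simp) (ENNReal.rpow_ne_top_of_nonneg (by linarith) (by simp)), ?_⟩
  intro h hm
  rw [lintegral_layer volume (HLM_measurable h) (by linarith : 0 < q)]
  have hq1 : 0 < q - 1 := by linarith
  set ν := (volume : Measure (Eucl n)).withDensity h with hν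
  have h2m : Measurable (fun x => 2 * h x) := hm.const_mul 2
  have e1 : ∫⁻ x, (2 * h x) ^ (q - 1) ∂ν = 2 ^ (q - 1) * ∫⁻ x, h x ^ q := by
    rw [hν, lintegral_withDensity_eq_lintegral_mul _ hm (h2m.pow_const _),
      ← lintegral_const_mul _ (hm.pow_const _)]
    congr 1; ext x
    simp only [Pi.mul_apply]
    rw [ENNReal.mul_rpow_of_nonneg _ _ hq1.le]
    have : h x ^ q = h x * h x ^ (q - 1) := by
      conv_lhs => rw [show q = 1 + (q - 1) by ring]
      rw [ENNReal.rpow_add_of_nonneg _ _ zero_le_one hq1.le, ENNReal.rpow_one]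
    rw [this]; ring
  rw [mul_assoc, ← e1, lintegral_layer ν h2m hq1, ← lintegral_const_mul' _ _ (by simp)]
  refine setLIntegral_mono' measurableSet_Ioi fun l hl => ?_
  have hl0 : 0 < l := hl
  have hS : MeasurableSet {x | ENNReal.ofReal l / 2 < h x} := measurableSet_lt measurable_const hm
  have hw := HLM_weak' hn hm (ENNReal.ofReal l)
  rw [← withDensity_apply _ hS] at hw
  have hset : {x | ENNReal.ofReal l / 2 < h x} = {x | ENNReal.ofReal l < 2 * h x} := by
    ext x
    simp only [Set.mem_ofPred_eq]
    rw [ENNReal.div_lt_iff (by simp) (by simp), mul_comm]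
  rw [hset] at hw
  have e2 : ENNReal.ofReal (q * l ^ (q - 1)) =
      ENNReal.ofReal (2 * q * l ^ (q - 1 - 1)) * (ENNReal.ofReal l / 2) := by
    have : ENNReal.ofReal l / 2 = ENNReal.ofReal (l / 2) := by
      rw [ENNReal.ofReal_div_of_pos (by norm_num)]; simp
    rw [this, ← ENNReal.ofReal_mul (by positivity)]
    congr 1
    rw [Real.rpow_sub_one hl0.ne' (q - 1)]
    field_simp
  calc _ = ENNReal.ofReal (2 * q * l ^ (q - 1 - 1)) *
        (volume {x | ENNReal.ofReal l < HLM h x} * (ENNReal.ofReal l / 2)) := by rw [e2]; ring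
    _ ≤ ENNReal.ofReal (2 * q * l ^ (q - 1 - 1)) * (ENNReal.ofReal (5 ^ n) * ν {x | ENNReal.ofReal l < 2 * h x}) := by
        gcongr
    _ = _ := by
        rw [← mul_assoc, ← mul_assoc, ← ENNReal.ofReal_mul (by positivity),
          ← ENNReal.ofReal_mul (by positivity)]
        congr 2
        field_simp

lemma kolmogorov {α : Type*} [MeasurableSpace α] (μ : Measure α) [SFinite μ] {δ : ℝ} (hδ : 0 < δ)
    (hδ1 : δ < 1) (S : Set α) {F : α → ℝ≥0∞} (hF : Measurable F) (a : ℝ≥0∞) (hS : μ S ≠ 0)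
    (H : ∀ l, μ {x | l < F x} * l ≤ μ S * a) :
    ∫⁻ x in S, F x ^ δ ∂μ ≤ ENNReal.ofReal (1 + δ / (1 - δ)) * (μ S * a ^ δ) := by
  have hδ2 : 0 < 1 - δ := by linarith
  rcases eq_or_ne a ⊤ with rfl | hat
  · rw [ENNReal.top_rpow_of_pos hδ, ENNReal.mul_top hS, ENNReal.mul_top]
    · exact le_top
    · simp; positivity
  obtain ⟨b, hb, rfl⟩ : ∃ b : ℝ, 0 ≤ b ∧ a = ENNReal.ofReal b :=
    ⟨a.toReal, ENNReal.toReal_nonneg, (ENNReal.ofReal_toReal hat).symm⟩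
  rw [lintegral_layer (μ.restrict S) hF hδ]
  rcases hb.eq_or_lt with rfl | hb
  · have : ∫⁻ l in Set.Ioi (0 : ℝ), ENNReal.ofReal (δ * l ^ (δ - 1)) *
        μ.restrict S {x | ENNReal.ofReal l < F x} ≤ ∫⁻ l in Set.Ioi (0 : ℝ), 0 := by
      refine setLIntegral_mono' measurableSet_Ioi fun l hl => ?_
      have hl0 : 0 < l := hl
      have h1 := H (ENNReal.ofReal l)
      simp only [ENNReal.ofReal_zero, mul_zero, nonpos_iff_eq_zero, mul_eq_zero,
        ENNReal.ofReal_eq_zero, not_le.2 hl0, or_false] at h1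
      have h2 := Measure.restrict_apply_le S {x | ENNReal.ofReal l < F x} (μ := μ)
      rw [h1, nonpos_iff_eq_zero] at h2
      rw [h2, mul_zero]
    exact this.trans (by simp)
  have key : ∀ l ∈ Set.Ioi (0 : ℝ), ENNReal.ofReal (δ * l ^ (δ - 1)) *
        μ.restrict S {x | ENNReal.ofReal l < F x} ≤
      μ S * ((if ENNReal.ofReal l < ENNReal.ofReal b then ENNReal.ofReal (δ * l ^ (δ - 1)) else 0) +
       ENNReal.ofReal b * Set.indicator (Set.Ici b) (fun l => ENNReal.ofReal (δ * l ^ (δ - 2))) l) := by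
    intro l hl
    have hl0 : 0 < l := hl
    by_cases hlb : l < b
    · rw [if_pos ((ENNReal.ofReal_lt_ofReal_iff hb).2 hlb), Set.indicator_of_notMem (by simpa using hlb),
        mul_zero, add_zero, mul_comm]
      refine mul_le_mul' ?_ le_rfl
      refine (measure_mono (Set.subset_univ _)).trans ?_
      simp
    · rw [if_neg (not_lt.2 (ENNReal.ofReal_le_ofReal (not_lt.1 hlb))),
        Set.indicator_of_mem (by simpa using hlb), zero_add]
      have h1 := H (ENNReal.ofReal l)
      have e2 : ENNReal.ofReal (δ * l ^ (δ - 1)) =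
          ENNReal.ofReal (δ * l ^ (δ - 2)) * ENNReal.ofReal l := by
        rw [← ENNReal.ofReal_mul (by positivity)]
        congr 1
        rw [show δ - 1 = (δ - 2) + 1 by ring, Real.rpow_add_one hl0.ne']
        ring
      rw [e2]
      calc _ ≤ ENNReal.ofReal (δ * l ^ (δ - 2)) * (μ {x | ENNReal.ofReal l < F x} * ENNReal.ofReal l) := by
            rw [mul_assoc, mul_comm (ENNReal.ofReal l)]
            exact mul_le_mul' le_rfl (mul_le_mul' (Measure.restrict_apply_le _ _) le_rfl)
        _ ≤ ENNReal.ofReal (δ * l ^ (δ - 2)) * (μ S * ENNReal.ofReal b) := by gcongr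
        _ = _ := by ring
  have m1 : Measurable (fun l : ℝ => if ENNReal.ofReal l < ENNReal.ofReal b then
      ENNReal.ofReal (δ * l ^ (δ - 1)) else 0) := by
    refine Measurable.ite (measurableSet_lt ?_ ?_) ?_ measurable_const <;> fun_prop
  have m2 : Measurable (Set.indicator (Set.Ici b) (fun l => ENNReal.ofReal (δ * l ^ (δ - 2)))) := by
    refine Measurable.indicator ?_ measurableSet_Ici
    fun_prop
  have i2 : ∫⁻ l in Set.Ioi (0 : ℝ), Set.indicator (Set.Ici b) (fun l => ENNReal.ofReal (δ * l ^ (δ - 2))) l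
      ≤ ENNReal.ofReal (δ / (1 - δ) * b ^ (δ - 1)) := by
    refine (setLIntegral_le_lintegral _ _).trans ?_
    rw [lintegral_indicator measurableSet_Ici, setLIntegral_congr Ioi_ae_eq_Ici.symm,
      ← ofReal_integral_eq_lintegral_ofReal]
    · rw [integral_const_mul, integral_Ioi_rpow_of_lt (by linarith) hb]
      apply ENNReal.ofReal_le_ofReal
      apply le_of_eq
      rw [show δ - 2 + 1 = -(1 - δ) by ring, show δ - 1 = -(1 - δ) by ring]
      field_simp
    · exact (integrableOn_Ioi_rpow_of_lt (by linarith) hb).const_mul δ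
    · filter_upwards [ae_restrict_mem measurableSet_Ioi] with l hl
      have : 0 < l := hb.trans hl
      simp only [Pi.zero_apply]
      positivity
  refine (setLIntegral_mono' measurableSet_Ioi key).trans ?_
  rw [lintegral_const_mul _ (by exact m1.add (m2.const_mul _)), lintegral_add_left m1,
    lintegral_const_mul _ m2, rpow_layer hδ]
  calc _ ≤ μ S * (ENNReal.ofReal b ^ δ + ENNReal.ofReal b * ENNReal.ofReal (δ / (1 - δ) * b ^ (δ - 1))) := by
        gcongr
    _ = _ := by
        rw [ENNReal.ofReal_rpow_of_pos hb, ← ENNReal.ofReal_mul hb.le,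
          ← ENNReal.ofReal_add (by positivity) (by positivity), mul_left_comm (ENNReal.ofReal (1 + δ / (1 - δ))),
          ← ENNReal.ofReal_mul (by positivity)]
        congr 2
        rw [Real.rpow_sub_one hb.ne']
        field_simp

lemma HLM_far {n : ℕ} (h : Eucl n → ℝ≥0∞) {c y : Eucl n} {ρ : ℝ} (hy : y ∈ Metric.ball c ρ)
    (T : ℝ≥0∞) (H : ∀ c' ρ', ρ < ρ' → y ∈ Metric.ball c' ρ' →
      ∫⁻ z in Metric.ball c' ρ', h z ≤ volume (Metric.ball c' ρ') * T) :
    HLM (Set.indicator (Metric.ball c (3 * ρ))ᶜ h) y ≤ T := by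
  refine HLM_le _ y _ fun c' ρ' hy' => ?_
  by_cases hρ : ρ < ρ'
  · refine le_trans (lintegral_mono fun z => ?_) (H c' ρ' hρ hy')
    exact Set.indicator_le_self _ _ _
  · have : ∫⁻ z in Metric.ball c' ρ', (Set.indicator (Metric.ball c (3 * ρ))ᶜ h) z =
        ∫⁻ z in Metric.ball c' ρ', 0 := by
      refine setLIntegral_congr_fun measurableSet_ball fun z hz => ?_
      refine Set.indicator_of_notMem ?_ _
      simp only [Set.mem_compl_iff, not_not]
      rw [Metric.mem_ball] at *
      have h1 := dist_triangle z c' c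
      have h2 := dist_triangle c' y c
      rw [dist_comm c' y] at h2
      linarith
    rw [this]; simp

lemma HLM_near_far {n : ℕ} {h : Eucl n → ℝ≥0∞} (hm : Measurable h) (c : Eucl n) (ρ : ℝ) (y : Eucl n) :
    HLM h y ≤ HLM (Set.indicator (Metric.ball c (3 * ρ)) h) y +
      HLM (Set.indicator (Metric.ball c (3 * ρ))ᶜ h) y := by
  refine le_trans (HLM_mono (fun z => ?_) y) (HLM_add_le (hm.indicator measurableSet_ball) y)
  rw [← Pi.add_apply, Set.indicator_self_add_compl]

/-- `A_1` condition over balls with explicit constant -/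
def IsA1 {n : ℕ} (K : ℝ≥0∞) (U : Eucl n → ℝ≥0∞) : Prop :=
  ∀ (c : Eucl n) (ρ : ℝ) (x : Eucl n), x ∈ Metric.ball c ρ →
    ∫⁻ y in Metric.ball c ρ, U y ≤ K * (volume (Metric.ball c ρ) * U x)

lemma HLM_A1 {n : ℕ} (hn : 1 ≤ n) {δ : ℝ} (hδ : 0 < δ) (hδ1 : δ < 1) :
    ∃ K : ℝ≥0∞, K ≠ ⊤ ∧ ∀ h : Eucl n → ℝ≥0∞, Measurable h → IsA1 K (fun x => HLM h x ^ δ) := by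
  refine ⟨ENNReal.ofReal (1 + δ / (1 - δ)) * ENNReal.ofReal (5 ^ n * 3 ^ n) ^ δ +
    ENNReal.ofReal (3 ^ n) ^ δ, ?_, ?_⟩
  · refine ENNReal.add_ne_top.2 ⟨ENNReal.mul_ne_top (by simp) ?_, ?_⟩ <;>
    exact ENNReal.rpow_ne_top_of_nonneg hδ.le ENNReal.ofReal_ne_top
  intro h hm c ρ x hx
  have hρ : 0 < ρ := Metric.pos_of_mem_ball hx
  set B := Metric.ball c ρ with hB
  set h1 := Set.indicator (Metric.ball c (3 * ρ)) h with hh1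
  set h2 := Set.indicator (Metric.ball c (3 * ρ))ᶜ h with hh2
  have far : ∀ y ∈ B, HLM h2 y ≤ ENNReal.ofReal (3 ^ n) * HLM h x := by
    intro y hy
    refine HLM_far h hy _ fun c' ρ' hρ' hy' => ?_
    have hx' : x ∈ Metric.ball c' (3 * ρ') := by
      rw [hB, Metric.mem_ball] at *
      have t1 := dist_triangle x c c'
      have t2 := dist_triangle c y c'
      rw [dist_comm c y] at t2
      linarith
    have := int_le_HLM h hx'
    rw [vol_ball_scale c' c' (by norm_num)] at this
    refine le_trans (lintegral_mono_set (Metric.ball_subset_ball (by linarith))) (this.trans_eq ?_)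
    ring
  have near : ∫⁻ y in B, HLM h1 y ^ δ ≤ ENNReal.ofReal (1 + δ / (1 - δ)) *
      (volume B * (ENNReal.ofReal (5 ^ n * 3 ^ n) * HLM h x) ^ δ) := by
    refine kolmogorov volume hδ hδ1 B (HLM_measurable h1) _ (vol_ball_ne_zero c hρ) fun l => ?_
    refine (HLM_weak hn h1 l).trans ?_
    rw [hh1, lintegral_indicator measurableSet_ball]
    have hx' : x ∈ Metric.ball c (3 * ρ) := Metric.ball_subset_ball (by linarith) hx
    have := int_le_HLM h hx'
    rw [vol_ball_scale c c (by norm_num)] at this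
    calc _ ≤ ENNReal.ofReal (5 ^ n) * (ENNReal.ofReal (3 ^ n) * volume (Metric.ball c ρ) * HLM h x) := by
          gcongr
      _ = _ := by rw [ENNReal.ofReal_mul (by positivity)]; ring
  calc ∫⁻ y in B, HLM h y ^ δ
      ≤ ∫⁻ y in B, (HLM h1 y ^ δ + (ENNReal.ofReal (3 ^ n) * HLM h x) ^ δ) := by
        refine setLIntegral_mono' measurableSet_ball fun y hy => ?_
        refine le_trans (ENNReal.rpow_le_rpow ((HLM_near_far hm c ρ y).trans
          (add_le_add le_rfl (far y hy))) hδ.le) ?_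
        exact ENNReal.rpow_add_le_add_rpow _ _ hδ.le hδ1.le
    _ = (∫⁻ y in B, HLM h1 y ^ δ) + (ENNReal.ofReal (3 ^ n) * HLM h x) ^ δ * volume B := by
        rw [lintegral_add_right _ measurable_const]; simp
    _ ≤ ENNReal.ofReal (1 + δ / (1 - δ)) *
      (volume B * (ENNReal.ofReal (5 ^ n * 3 ^ n) * HLM h x) ^ δ) +
        (ENNReal.ofReal (3 ^ n) * HLM h x) ^ δ * volume B := by gcongr
    _ = _ := by
        rw [ENNReal.mul_rpow_of_nonneg _ _ hδ.le, ENNReal.mul_rpow_of_nonneg _ _ hδ.le]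
        ring

lemma HLM_pos {n : ℕ} {h : Eucl n → ℝ≥0∞} (hI : ∫⁻ y, h y ≠ 0) (x : Eucl n) : 0 < HLM h x := by
  by_contra hcon
  have h0 : HLM h x = 0 := by simpa using hcon
  apply hI
  have h1 : ∀ k : ℕ, ∫⁻ y in Metric.ball x k, h y = 0 := by
    intro k
    rcases Nat.eq_zero_or_pos k with rfl | hk
    · simp
    · have := int_le_HLM h (Metric.mem_ball_self (x := x) (by exact_mod_cast hk : (0 : ℝ) < k))
      rw [h0, mul_zero] at this
      simpa using this
  have h2 : (⋃ k : ℕ, Metric.ball x (k : ℝ)) = Set.univ := Metric.iUnion_ball_nat x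
  rw [← setLIntegral_univ, ← h2]
  refine le_antisymm ((lintegral_iUnion_le _ _).trans ?_) zero_le
  simp [h1]

lemma le_HLM_ae {n : ℕ} {h : Eucl n → ℝ≥0∞} (hm : Measurable h) :
    ∀ᵐ x, h x ≤ HLM h x := by
  have key : ∀ q : ℚ, ∀ᵐ x : Eucl n, ((Real.toNNReal q : ℝ≥0) : ℝ≥0∞) < h x →
      ((Real.toNNReal q : ℝ≥0) : ℝ≥0∞) ≤ HLM h x := by
    intro q
    set l : ℝ≥0∞ := ((Real.toNNReal q : ℝ≥0) : ℝ≥0∞) with hl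
    have hS : MeasurableSet {x | l < h x} := measurableSet_lt measurable_const hm
    have := Besicovitch.ae_tendsto_measure_inter_div (volume : Measure (Eucl n)) {x | l < h x}
    rw [ae_restrict_iff' hS] at this
    filter_upwards [this] with x hx hlx
    have h1 := ENNReal.Tendsto.const_mul (a := l) (hx hlx) (Or.inl one_ne_zero)
    rw [mul_one] at h1
    refine le_of_tendsto h1 ?_
    filter_upwards [self_mem_nhdsWithin] with ρ hρ
    have hρ0 : 0 < ρ := hρ
    refine le_trans ?_ (avg_le_HLM h (Metric.mem_ball_self (x := x) hρ0))
    have e1 : volume ({x | l < h x} ∩ Metric.closedBall x ρ) ≤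
        volume ({x | l < h x} ∩ Metric.ball x ρ) := by
      rw [← Metric.ball_union_sphere, Set.inter_union_distrib_left]
      refine (measure_union_le _ _).trans ?_
      have : volume ({x | l < h x} ∩ Metric.sphere x ρ) = 0 :=
        measure_mono_null Set.inter_subset_right
          (Measure.addHaar_sphere_of_ne_zero volume x hρ0.ne')
      rw [this, add_zero]
    rw [ENNReal.div_eq_inv_mul, mul_left_comm]
    refine mul_le_mul' (ENNReal.inv_le_inv.2 (measure_mono Metric.ball_subset_closedBall)) ?_
    calc _ ≤ l * volume ({x | l < h x} ∩ Metric.ball x ρ) := by gcongr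
      _ = ∫⁻ y in {x | l < h x} ∩ Metric.ball x ρ, l := by simp
      _ ≤ ∫⁻ y in {x | l < h x} ∩ Metric.ball x ρ, h y :=
          setLIntegral_mono' (hS.inter measurableSet_ball) fun y hy => hy.1.le
      _ ≤ _ := lintegral_mono_set Set.inter_subset_right
  filter_upwards [ae_all_iff.2 key] with x hx
  by_contra hcon
  obtain ⟨q, _, h1, h2⟩ := ENNReal.lt_iff_exists_rat_btwn.1 (not_le.1 hcon)
  exact absurd (hx q h2) (not_le.2 h1)

lemma cube_measurable {n : ℕ} (x : Eucl n) (r : ℝ) : MeasurableSet (cubeSet x r) := by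
  have : cubeSet x r = ⋂ i, {y : Eucl n | |x i - y i| ≤ r} := by
    ext y; simp [cubeSet]
  rw [this]
  refine MeasurableSet.iInter fun i => measurableSet_le ?_ measurable_const
  fun_prop

lemma ball_sub_cube {n : ℕ} (x : Eucl n) (r : ℝ) : Metric.ball x r ⊆ cubeSet x r := by
  intro y hy i
  have h1 : ‖(x - y) i‖ ≤ ‖x - y‖ := PiLp.norm_apply_le (x - y) i
  rw [Metric.mem_ball, dist_comm, dist_eq_norm] at hy
  have : |x i - y i| = ‖(x - y) i‖ := by simp [Real.norm_eq_abs]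
  rw [this]
  exact h1.trans hy.le

lemma cube_sub_ball {n : ℕ} (x : Eucl n) {r : ℝ} (hr : 0 < r) :
    cubeSet x r ⊆ Metric.ball x ((n + 1 : ℝ) * r) := by
  intro y hy
  rw [Metric.mem_ball, dist_comm, EuclideanSpace.dist_eq]
  rw [Real.sqrt_lt' (by positivity)]
  have h1 : ∑ i, dist (x i) (y i) ^ 2 ≤ ∑ i : Fin n, r ^ 2 := by
    refine Finset.sum_le_sum fun i _ => ?_
    rw [Real.dist_eq]
    exact pow_le_pow_left₀ (abs_nonneg _) (hy i) 2
  simp only [Finset.sum_const, Finset.card_univ, Fintype.card_fin, nsmul_eq_mul] at h1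
  refine h1.trans_lt ?_
  have : (0 : ℝ) ≤ n := Nat.cast_nonneg n
  have hr2 : 0 < r ^ 2 := by positivity
  nlinarith [mul_nonneg this hr2.le, mul_nonneg (mul_nonneg this this) hr2.le]

lemma vol_cube_ne_zero {n : ℕ} (x : Eucl n) {r : ℝ} (hr : 0 < r) : volume (cubeSet x r) ≠ 0 := by
  intro h
  exact vol_ball_ne_zero x hr (measure_mono_null (ball_sub_cube x r) h)

lemma vol_cube_ne_top {n : ℕ} (x : Eucl n) {r : ℝ} (hr : 0 < r) : volume (cubeSet x r) ≠ ⊤ :=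
  ((measure_mono (cube_sub_ball x hr)).trans_lt (vol_ball_ne_top x _).lt_top).ne

lemma cube_A1 {n : ℕ} {K : ℝ≥0∞} {U : Eucl n → ℝ≥0∞} (hU : IsA1 K U) (x : Eucl n) {r : ℝ}
    (hr : 0 < r) {y : Eucl n} (hy : y ∈ cubeSet x r) :
    (volume (cubeSet x r))⁻¹ * ∫⁻ z in cubeSet x r, U z ≤ K * ENNReal.ofReal ((n + 1 : ℝ) ^ n) * U y := by
  rw [ENNReal.inv_mul_le_iff (vol_cube_ne_zero x hr) (vol_cube_ne_top x hr)]
  refine (lintegral_mono_set (cube_sub_ball x hr)).trans ((hU x _ y (cube_sub_ball x hr hy)).trans ?_)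
  rw [vol_ball_scale x x (by positivity)]
  calc _ ≤ K * (ENNReal.ofReal ((n + 1 : ℝ) ^ n) * volume (cubeSet x r) * U y) := by
        gcongr; exact ball_sub_cube x r
    _ = _ := by ring

lemma ap_algebra {p : ℝ} (hp : 1 < p) {a b K L : ℝ≥0∞} (ha : a ≠ 0) (ha' : a ≠ ⊤) (hb : b ≠ 0)
    (hb' : b ≠ ⊤) :
    ((a / K) ^ (1 - p) * b) * (a * (b / L) ^ (-(1 / (p - 1)))) ^ (p - 1) = K ^ (p - 1) * L := by
  have hp' : 0 < p - 1 := by linarith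
  rw [ENNReal.mul_rpow_of_nonneg _ _ hp'.le, ← ENNReal.rpow_mul,
    show -(1 / (p - 1)) * (p - 1) = -1 by field_simp, ENNReal.rpow_neg_one,
    show 1 - p = -(p - 1) by ring, ENNReal.rpow_neg, ← ENNReal.inv_rpow,
    ENNReal.inv_div (Or.inr ha') (Or.inr ha), ENNReal.inv_div (Or.inr hb') (Or.inr hb),
    ENNReal.div_rpow_of_nonneg _ _ hp'.le]
  have h1 : a ^ (p - 1) ≠ 0 := by
    rw [Ne, ENNReal.rpow_eq_zero_iff]; push Not
    exact ⟨fun h => absurd h ha, fun h => absurd h ha'⟩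
  have h2 : a ^ (p - 1) ≠ ⊤ := ENNReal.rpow_ne_top_of_nonneg hp'.le ha'
  calc K ^ (p - 1) / a ^ (p - 1) * b * (a ^ (p - 1) * (L / b))
      = (K ^ (p - 1) / a ^ (p - 1) * a ^ (p - 1)) * (L / b * b) := by ring
    _ = _ := by rw [ENNReal.div_mul_cancel h1 h2, ENNReal.div_mul_cancel hb hb']

lemma ap_bound {n : ℕ} {p : ℝ} (hp : 1 < p) {K L : ℝ≥0∞} (hL' : L ≠ ⊤) (hK' : K ≠ ⊤)
    {H W : Eucl n → ℝ≥0∞} (hHm : Measurable H) (hWm : Measurable W)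
    (hH : IsA1 K H) (hW : IsA1 L W) (hH0 : ∀ᵐ x, 0 < H x ∧ H x < ⊤) (hW0 : ∀ᵐ x, 0 < W x ∧ W x < ⊤) :
    apConst n p (fun x => H x ^ (1 - p) * W x) ≤
      (K * ENNReal.ofReal ((n + 1 : ℝ) ^ n)) ^ (p - 1) * (L * ENNReal.ofReal ((n + 1 : ℝ) ^ n)) := by
  have hp' : 0 < p - 1 := by linarith
  unfold apConst
  refine iSup_le fun x => iSup_le fun r => iSup_le fun hr => ?_
  set Q := cubeSet x r with hQ
  set a := (volume Q)⁻¹ * ∫⁻ z in Q, H z with ha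
  set b := (volume Q)⁻¹ * ∫⁻ z in Q, W z with hb
  set K' := K * ENNReal.ofReal ((n + 1 : ℝ) ^ n)
  set L' := L * ENNReal.ofReal ((n + 1 : ℝ) ^ n)
  have hLt : L' ≠ ⊤ := ENNReal.mul_ne_top hL' ENNReal.ofReal_ne_top
  have hKt : K' ≠ ⊤ := ENNReal.mul_ne_top hK' ENNReal.ofReal_ne_top
  have hQm : MeasurableSet Q := cube_measurable x r
  have hV0 : volume Q ≠ 0 := vol_cube_ne_zero x hr
  have hVt : volume Q ≠ ⊤ := vol_cube_ne_top x hr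
  have hV0' : (volume Q)⁻¹ ≠ 0 := ENNReal.inv_ne_zero.2 hVt
  have hVt' : (volume Q)⁻¹ ≠ ⊤ := ENNReal.inv_ne_top.2 hV0
  have aH : ∀ y ∈ Q, a ≤ K' * H y := fun y hy => cube_A1 hH x hr hy
  have bW : ∀ y ∈ Q, b ≤ L' * W y := fun y hy => cube_A1 hW x hr hy
  obtain ⟨y, hyQ, hy⟩ : ∃ y ∈ Q, (0 < H y ∧ H y < ⊤) ∧ (0 < W y ∧ W y < ⊤) := by
    by_contra hcon
    push Not at hcon
    have : volume Q = 0 := by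
      refine measure_mono_null ?_ (ae_iff.1 (hH0.and hW0))
      intro y hy hy'
      exact absurd hy'.2.2 (not_lt.2 (hcon y hy hy'.1 hy'.2.1))
    exact hV0 this
  have posI : ∀ U : Eucl n → ℝ≥0∞, Measurable U → (∀ᵐ x, 0 < U x ∧ U x < ⊤) →
      (volume Q)⁻¹ * ∫⁻ z in Q, U z ≠ 0 := by
    intro U hU hU0
    refine mul_ne_zero hV0' ?_
    intro h0
    rw [lintegral_eq_zero_iff hU] at h0
    have h1 : ∀ᵐ z ∂(volume.restrict Q), False := by
      filter_upwards [h0, ae_restrict_of_ae hU0] with z hz hz'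
      exact hz'.1.ne' hz
    rw [Filter.eventually_false_iff_eq_bot, ae_eq_bot, Measure.restrict_eq_zero] at h1
    exact hV0 h1
  have ha0 : a ≠ 0 := posI H hHm hH0
  have hb0 : b ≠ 0 := posI W hWm hW0
  have hat : a ≠ ⊤ := ((aH y hyQ).trans_lt (ENNReal.mul_lt_top hKt.lt_top hy.1.2)).ne
  have hbt : b ≠ ⊤ := ((bW y hyQ).trans_lt (ENNReal.mul_lt_top hLt.lt_top hy.2.2)).ne
  have hL0 : L' ≠ 0 := by
    intro h0
    have := bW y hyQ
    rw [h0, zero_mul] at this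
    exact hb0 (by simpa using this)
  have hK0 : K' ≠ 0 := by
    intro h0
    have := aH y hyQ
    rw [h0, zero_mul] at this
    exact ha0 (by simpa using this)
  rw [← ap_algebra hp ha0 hat hb0 hbt (L := L') (K := K')]
  have neg_mono : ∀ {s t : ℝ≥0∞} {z : ℝ}, 0 ≤ z → s ≤ t → t ^ (-z) ≤ s ^ (-z) := by
    intro s t z hz hst
    rw [ENNReal.rpow_neg, ENNReal.rpow_neg]
    exact ENNReal.inv_le_inv.2 (ENNReal.rpow_le_rpow hst hz)
  refine mul_le_mul' ?_ (ENNReal.rpow_le_rpow ?_ hp'.le)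
  · have cne : (a / K') ^ (1 - p) ≠ ⊤ := by
      rw [Ne, ENNReal.rpow_eq_top_iff]; push Not
      exact ⟨fun h => absurd h (ENNReal.div_pos ha0 hKt).ne',
        fun h => absurd h (ENNReal.div_lt_top hat hK0).ne⟩
    rw [hb, mul_left_comm, ← lintegral_const_mul' _ _ cne]
    refine mul_le_mul' le_rfl (setLIntegral_mono' hQm fun z hz => ?_)
    refine mul_le_mul' ?_ le_rfl
    rw [show 1 - p = -(p - 1) by ring]
    exact neg_mono hp'.le (ENNReal.div_le_of_le_mul' (aH z hz))
  · have cne : (b / L') ^ (-(1 / (p - 1))) ≠ ⊤ := by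
      rw [Ne, ENNReal.rpow_eq_top_iff]; push Not
      exact ⟨fun h => absurd h (ENNReal.div_pos hb0 hLt).ne',
        fun h => absurd h (ENNReal.div_lt_top hbt hL0).ne⟩
    rw [ha, mul_assoc, ← lintegral_mul_const' _ _ cne]
    refine mul_le_mul' le_rfl (lintegral_mono_ae ?_)
    filter_upwards [ae_restrict_mem hQm, ae_restrict_of_ae hH0, ae_restrict_of_ae hW0] with z hz h1 h2
    rw [ENNReal.mul_rpow_of_ne_zero _ h2.1.ne', ← ENNReal.rpow_mul,
      show (1 - p) * -(1 / (p - 1)) = 1 by field_simp; ring, ENNReal.rpow_one]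
    · refine mul_le_mul' le_rfl ?_
      exact neg_mono (by positivity) (ENNReal.div_le_of_le_mul' (bW z hz))
    · rw [Ne, ENNReal.rpow_eq_zero_iff]; push Not
      exact ⟨fun h => absurd h h1.1.ne', fun h => absurd h h1.2.ne⟩

lemma one_le_ap {n : ℕ} {p : ℝ} (hp : 1 < p) {w : Eucl n → ℝ≥0∞} (hw : IsWeight w) :
    1 ≤ apConst n p w := by
  have hp' : 0 < p - 1 := by linarith
  have hp0 : 0 < p := by linarith
  unfold apConst
  refine le_iSup_of_le 0 (le_iSup_of_le 1 (le_iSup_of_le one_pos ?_))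
  set Q := cubeSet (0 : Eucl n) 1 with hQ
  have hV0 : volume Q ≠ 0 := vol_cube_ne_zero 0 one_pos
  have hVt : volume Q ≠ ⊤ := vol_cube_ne_top 0 one_pos
  have hc : p.HolderConjugate (p / (p - 1)) := Real.HolderConjugate.conjExponent hp
  have hH := ENNReal.lintegral_mul_le_Lp_mul_Lq (volume.restrict Q) hc
    (f := fun x => w x ^ (1 / p)) (g := fun x => w x ^ (-(1 / p)))
    (hw.1.pow_const _).aemeasurable (hw.1.pow_const _).aemeasurable
  have e1 : ∫⁻ a in Q, ((fun x => w x ^ (1 / p)) * fun x => w x ^ (-(1 / p))) a = volume Q := by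
    have : ∫⁻ a in Q, ((fun x => w x ^ (1 / p)) * fun x => w x ^ (-(1 / p))) a = ∫⁻ a in Q, 1 := by
      refine lintegral_congr_ae (ae_restrict_of_ae ?_)
      filter_upwards [hw.2] with z hz
      simp only [Pi.mul_apply]
      rw [← ENNReal.rpow_add _ _ hz.1.ne' hz.2.ne, add_neg_cancel, ENNReal.rpow_zero]
    rw [this]; simp
  have e2 : ∀ x, (w x ^ (1 / p)) ^ p = w x := fun x => by
    rw [← ENNReal.rpow_mul, one_div_mul_cancel hp0.ne', ENNReal.rpow_one]
  have e3 : ∀ x, (w x ^ (-(1 / p))) ^ (p / (p - 1)) = w x ^ (-(1 / (p - 1))) := fun x => by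
    rw [← ENNReal.rpow_mul]; congr 1; field_simp
  simp only [e2, e3] at hH
  rw [e1] at hH
  have h2 := ENNReal.rpow_le_rpow hH hp0.le
  rw [ENNReal.mul_rpow_of_nonneg _ _ hp0.le, ← ENNReal.rpow_mul, one_div_mul_cancel hp0.ne',
    ENNReal.rpow_one, ← ENNReal.rpow_mul, show 1 / (p / (p - 1)) * p = p - 1 by field_simp] at h2
  rw [ENNReal.mul_rpow_of_nonneg _ _ hp'.le, ENNReal.inv_rpow]
  set I := ∫⁻ y in Q, w y
  set J := (∫⁻ y in Q, w y ^ (-(1 / (p - 1)))) ^ (p - 1)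
  have e4 : volume Q ^ p = volume Q * volume Q ^ (p - 1) := by
    conv_lhs => rw [show p = 1 + (p - 1) by ring]
    rw [ENNReal.rpow_add _ _ hV0 hVt, ENNReal.rpow_one]
  have hVp0 : volume Q ^ p ≠ 0 := by
    rw [Ne, ENNReal.rpow_eq_zero_iff]; push Not
    exact ⟨fun h => absurd h hV0, fun h => absurd h hVt⟩
  have hVpt : volume Q ^ p ≠ ⊤ := ENNReal.rpow_ne_top_of_nonneg hp0.le hVt
  calc (1 : ℝ≥0∞) = (volume Q ^ p)⁻¹ * volume Q ^ p := (ENNReal.inv_mul_cancel hVp0 hVpt).symm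
    _ ≤ (volume Q ^ p)⁻¹ * (I * J) := by gcongr
    _ = _ := by
      rw [e4, ENNReal.mul_inv (Or.inl hV0) (Or.inl hVt)]; ring

lemma memAp_one {n : ℕ} (p : ℝ) : MemAp n p (fun _ => 1) := by
  refine ⟨⟨measurable_const, by simp⟩, lt_of_le_of_lt (b := 1) ?_ (by simp)⟩
  unfold apConst
  refine iSup_le fun x => iSup_le fun r => iSup_le fun hr => ?_
  simp only [ENNReal.one_rpow, lintegral_const, MeasurableSet.univ, Measure.restrict_apply,
    Set.univ_inter, one_mul]
  rw [ENNReal.inv_mul_cancel (vol_cube_ne_zero x hr) (vol_cube_ne_top x hr)]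
  simp

lemma lint_pow_le {α : Type*} [MeasurableSpace α] (μ : Measure α) {F : α → ℝ≥0∞} (hF : Measurable F)
    {t r : ℝ} (ht : 0 < t) (htr : t ≤ r) (S : Set α) :
    ∫⁻ x in S, F x ^ t ∂μ ≤ (∫⁻ x in S, F x ^ r ∂μ) ^ (t / r) * μ S ^ (1 - t / r) := by
  have hr : 0 < r := by linarith
  have h := ENNReal.lintegral_mul_norm_pow_le (μ := μ.restrict S) (f := fun x => F x ^ r)
    (g := fun _ => 1) (hF.pow_const r).aemeasurable aemeasurable_const
    (p := t / r) (q := 1 - t / r) (by positivity) (by rw [sub_nonneg, div_le_one hr]; exact htr)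
    (by ring)
  have e : ∀ x, (F x ^ r) ^ (t / r) = F x ^ t := fun x => by
    rw [← ENNReal.rpow_mul, mul_div_cancel₀ _ hr.ne']
  simpa [e] using h

lemma rpow_ne_zero' {a : ℝ≥0∞} (h0 : a ≠ 0) (ht : a ≠ ⊤) (z : ℝ) : a ^ z ≠ 0 := by
  rw [Ne, ENNReal.rpow_eq_zero_iff]; push Not
  exact ⟨fun h => absurd h h0, fun h => absurd h ht⟩

lemma rpow_ne_top' {a : ℝ≥0∞} (h0 : a ≠ 0) (ht : a ≠ ⊤) (z : ℝ) : a ^ z ≠ ⊤ := by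
  rw [Ne, ENNReal.rpow_eq_top_iff]; push Not
  exact ⟨fun h => absurd h h0, fun h => absurd h ht⟩

/-- local Morrey bound -/
def MB {n : ℕ} (r r0 : ℝ) (m : ℝ≥0∞) (F : Eucl n → ℝ≥0∞) : Prop :=
  ∀ (c : Eucl n) (ρ : ℝ), 0 < ρ →
    ∫⁻ y in Metric.ball c ρ, F y ^ r ≤ (m * volume (Metric.ball c ρ) ^ (1 / r - 1 / r0)) ^ r

lemma morrey_MB {n : ℕ} {r r0 : ℝ} (hr : 1 < r) (F : Eucl n → ℝ≥0∞) :
    MB r r0 (morreyE n r r0 F) F := by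
  intro c ρ hρ
  have hr0 : 0 < r := by linarith
  have hV0 := vol_ball_ne_zero c hρ
  have hVt := vol_ball_ne_top c ρ
  have h1 : volume (Metric.ball c ρ) ^ (1 / r0 - 1 / r) *
      (∫⁻ y in Metric.ball c ρ, F y ^ r) ^ (1 / r) ≤ morreyE n r r0 F := by
    unfold morreyE
    exact le_iSup_of_le c (le_iSup_of_le ρ (le_iSup_of_le hρ le_rfl))
  have h2 : (∫⁻ y in Metric.ball c ρ, F y ^ r) ^ (1 / r) ≤
      morreyE n r r0 F * volume (Metric.ball c ρ) ^ (1 / r - 1 / r0) := by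
    calc _ = volume (Metric.ball c ρ) ^ (1 / r0 - 1 / r) *
      (∫⁻ y in Metric.ball c ρ, F y ^ r) ^ (1 / r) * volume (Metric.ball c ρ) ^ (1 / r - 1 / r0) := by
          rw [mul_right_comm, ← ENNReal.rpow_add _ _ hV0 hVt]
          simp
      _ ≤ _ := by gcongr
  have h3 := ENNReal.rpow_le_rpow h2 hr0.le
  rwa [← ENNReal.rpow_mul, one_div_mul_cancel hr0.ne', ENNReal.rpow_one] at h3

lemma MB_HLM {n : ℕ} (hn : 1 ≤ n) {r r0 t : ℝ} (hrr : r ≤ r0) (ht : 1 < t) (htr : t < r) :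
    ∃ C : ℝ≥0∞, C ≠ ⊤ ∧ ∀ (F : Eucl n → ℝ≥0∞) (m : ℝ≥0∞), Measurable F → MB r r0 m F →
      MB r r0 (C * m) (fun x => HLM (fun y => F y ^ t) x ^ (1 / t)) := by
  have hr0 : 0 < r := by linarith
  have ht0 : 0 < t := by linarith
  have hr00 : 0 < r0 := by linarith
  have hq : 1 < r / t := by rwa [one_lt_div ht0]
  have hσ : 0 ≤ 1 / r - 1 / r0 := by
    rw [sub_nonneg]; exact one_div_le_one_div_of_le hr0 hrr
  obtain ⟨Cs, hCs, hs⟩ := HLM_strong hn hq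
  set D : ℝ≥0∞ := 2 ^ (r / t - 1) * (Cs * (ENNReal.ofReal (3 ^ n) ^ (1 / r - 1 / r0)) ^ r + 1) with hD
  have hDt : D ≠ ⊤ := by
    refine ENNReal.mul_ne_top (ENNReal.rpow_ne_top_of_nonneg (by linarith) (by simp)) ?_
    refine ENNReal.add_ne_top.2 ⟨ENNReal.mul_ne_top hCs ?_, by simp⟩
    exact ENNReal.rpow_ne_top_of_nonneg hr0.le (ENNReal.rpow_ne_top_of_nonneg hσ ENNReal.ofReal_ne_top)
  refine ⟨D ^ (1 / r), ENNReal.rpow_ne_top_of_nonneg (by positivity) hDt, ?_⟩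
  intro F m hF hMB c ρ hρ
  set V := volume (Metric.ball c ρ) with hV
  have hV0 : V ≠ 0 := vol_ball_ne_zero c hρ
  have hVt : V ≠ ⊤ := vol_ball_ne_top c ρ
  set G : Eucl n → ℝ≥0∞ := fun y => F y ^ t with hG
  have hGm : Measurable G := hF.pow_const t
  set T := (m * V ^ (-(1 / r0))) ^ t with hT
  have far : ∀ y ∈ Metric.ball c ρ, HLM (Set.indicator (Metric.ball c (3 * ρ))ᶜ G) y ≤ T := by
    intro y hy
    refine HLM_far G hy _ fun c' ρ' hρ' hy' => ?_
    have hρ'0 : 0 < ρ' := hρ.trans hρ'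
    set V' := volume (Metric.ball c' ρ') with hV'
    have hV'0 : V' ≠ 0 := vol_ball_ne_zero c' hρ'0
    have hV't : V' ≠ ⊤ := vol_ball_ne_top c' ρ'
    have hVV : V ≤ V' := by
      rw [hV, hV', Measure.addHaar_ball_center volume c, Measure.addHaar_ball_center volume c']
      exact measure_mono (Metric.ball_subset_ball hρ'.le)
    calc _ ≤ _ := lint_pow_le volume hF ht0 htr.le (Metric.ball c' ρ')
      _ ≤ ((m * V' ^ (1 / r - 1 / r0)) ^ r) ^ (t / r) * V' ^ (1 - t / r) := by
          gcongr
          exact hMB c' ρ' hρ'0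
      _ = V' * (m * V' ^ (-(1 / r0))) ^ t := by
          rw [← ENNReal.rpow_mul, mul_div_cancel₀ _ hr0.ne', ENNReal.mul_rpow_of_nonneg _ _ ht0.le,
            ENNReal.mul_rpow_of_nonneg _ _ ht0.le, mul_assoc, ← ENNReal.rpow_mul,
            ← ENNReal.rpow_add _ _ hV'0 hV't, mul_left_comm]
          congr 1
          conv_rhs => rw [← ENNReal.rpow_mul]
          nth_rewrite 2 [← ENNReal.rpow_one V']
          rw [← ENNReal.rpow_add _ _ hV'0 hV't]
          congr 1
          field_simp
          ring
      _ ≤ _ := by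
          rw [hT, ENNReal.rpow_neg, ENNReal.rpow_neg]
          gcongr
  have e1 : ∀ x, (HLM G x ^ (1 / t)) ^ r = HLM G x ^ (r / t) := fun x => by
    rw [← ENNReal.rpow_mul]; congr 1; ring
  simp only [e1]
  set h1 := Set.indicator (Metric.ball c (3 * ρ)) G with hh1
  have h1m : Measurable h1 := hGm.indicator measurableSet_ball
  have near : ∫⁻ y, HLM h1 y ^ (r / t) ≤ Cs *
      ((ENNReal.ofReal (3 ^ n) ^ (1 / r - 1 / r0)) ^ r * (m * V ^ (1 / r - 1 / r0)) ^ r) := by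
    refine (hs h1 h1m).trans ?_
    gcongr
    have : (fun x => h1 x ^ (r / t)) = Set.indicator (Metric.ball c (3 * ρ)) (fun x => F x ^ r) := by
      ext x
      by_cases hx : x ∈ Metric.ball c (3 * ρ)
      · rw [hh1, Set.indicator_of_mem hx, Set.indicator_of_mem hx, hG, ← ENNReal.rpow_mul,
          mul_div_cancel₀ _ ht0.ne']
      · rw [hh1, Set.indicator_of_notMem hx, Set.indicator_of_notMem hx,
          ENNReal.zero_rpow_of_pos (by positivity)]
    rw [this, lintegral_indicator measurableSet_ball]
    refine (hMB c (3 * ρ) (by positivity)).trans_eq ?_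
    rw [vol_ball_scale c c (by norm_num), ENNReal.mul_rpow_of_nonneg _ _ hσ,
      ← ENNReal.mul_rpow_of_nonneg _ _ hr0.le]
    congr 1
    ring
  calc ∫⁻ y in Metric.ball c ρ, HLM G y ^ (r / t)
      ≤ ∫⁻ y in Metric.ball c ρ, 2 ^ (r / t - 1) * (HLM h1 y ^ (r / t) + T ^ (r / t)) := by
        refine setLIntegral_mono' measurableSet_ball fun y hy => ?_
        refine le_trans (ENNReal.rpow_le_rpow ((HLM_near_far hGm c ρ y).trans
          (add_le_add le_rfl (far y hy))) (by positivity)) ?_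
        exact ENNReal.rpow_add_le_mul_rpow_add_rpow _ _ hq.le
    _ = 2 ^ (r / t - 1) * ((∫⁻ y in Metric.ball c ρ, HLM h1 y ^ (r / t)) + T ^ (r / t) * V) := by
        rw [lintegral_const_mul' _ _ (ENNReal.rpow_ne_top_of_nonneg (by linarith) (by simp)),
          lintegral_add_right _ measurable_const]
        simp [hV]
    _ ≤ 2 ^ (r / t - 1) * (Cs *
      ((ENNReal.ofReal (3 ^ n) ^ (1 / r - 1 / r0)) ^ r * (m * V ^ (1 / r - 1 / r0)) ^ r) +
        (m * V ^ (1 / r - 1 / r0)) ^ r) := by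
        gcongr
        · exact (setLIntegral_le_lintegral _ _).trans near
        · apply le_of_eq
          rw [hT, ← ENNReal.rpow_mul, mul_div_cancel₀ _ ht0.ne', ENNReal.mul_rpow_of_nonneg _ _ hr0.le,
            ENNReal.mul_rpow_of_nonneg _ _ hr0.le, mul_assoc, ← ENNReal.rpow_mul, ← ENNReal.rpow_mul]
          congr 1
          nth_rewrite 2 [← ENNReal.rpow_one V]
          rw [← ENNReal.rpow_add _ _ hV0 hVt]
          congr 1
          field_simp
          ring
    _ = D * (m * V ^ (1 / r - 1 / r0)) ^ r := by rw [hD]; ring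
    _ = _ := by
        rw [mul_assoc (D ^ (1 / r)), ENNReal.mul_rpow_of_nonneg (D ^ (1 / r)) _ hr0.le, ← ENNReal.rpow_mul,
          one_div_mul_cancel hr0.ne', ENNReal.rpow_one]

lemma univ_dyadic {n : ℕ} (c : Eucl n) {ρ : ℝ} (hρ : 0 < ρ) :
    (Set.univ : Set (Eucl n)) ⊆ Metric.ball c (2 * ρ) ∪
      ⋃ k : ℕ, (Metric.ball c (4 * 2 ^ k * ρ) \ Metric.ball c (2 * 2 ^ k * ρ)) := by
  intro y _
  by_cases h : y ∈ Metric.ball c (2 * ρ)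
  · exact Or.inl h
  right
  have hex : ∃ k : ℕ, y ∈ Metric.ball c (4 * 2 ^ k * ρ) := by
    obtain ⟨k, hk⟩ := pow_unbounded_of_one_lt (dist y c / ρ) (one_lt_two)
    refine ⟨k, ?_⟩
    rw [Metric.mem_ball]
    rw [div_lt_iff₀ hρ] at hk
    have : 0 < (2 : ℝ) ^ k * ρ := by positivity
    linarith
  classical
  refine Set.mem_iUnion.2 ⟨Nat.find hex, Nat.find_spec hex, ?_⟩
  rcases hk : Nat.find hex with _ | k
  · simpa using h
  · have := Nat.find_min hex (m := k) (by omega)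
    rwa [show (2 : ℝ) * 2 ^ (k + 1) = 4 * 2 ^ k by ring]

lemma HLM_supp {n : ℕ} {φ : Eucl n → ℝ≥0∞} {c : Eucl n} {ρ : ℝ} (hρ : 0 < ρ)
    (hsupp : ∀ y, y ∉ Metric.ball c ρ → φ y = 0) (k : ℕ) {y : Eucl n}
    (hy : y ∉ Metric.ball c (2 * 2 ^ k * ρ)) (T : ℝ≥0∞)
    (hT : ∫⁻ z in Metric.ball c ρ, φ z ≤ ENNReal.ofReal ((2 ^ k / 2) ^ n) * volume (Metric.ball c ρ) * T) :
    HLM φ y ≤ T := by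
  refine HLM_le _ y _ fun c' ρ' hy' => ?_
  have e : φ = Set.indicator (Metric.ball c ρ) φ := by
    ext z
    by_cases hz : z ∈ Metric.ball c ρ
    · rw [Set.indicator_of_mem hz]
    · rw [Set.indicator_of_notMem hz, hsupp z hz]
  by_cases h : ρ' ≤ 2 ^ k / 2 * ρ
  · have : ∫⁻ z in Metric.ball c' ρ', φ z = ∫⁻ z in Metric.ball c' ρ', 0 := by
      refine setLIntegral_congr_fun measurableSet_ball fun z hz => hsupp z fun hz' => hy ?_
      rw [Metric.mem_ball] at *
      have t1 := dist_triangle y c' c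
      have t2 := dist_triangle c' z c
      rw [dist_comm c' z] at t2
      have : (1 : ℝ) ≤ 2 ^ k := one_le_pow₀ (by norm_num)
      have : ρ ≤ 2 ^ k * ρ := by nlinarith
      nlinarith
    rw [this]; simp
  · push Not at h
    calc ∫⁻ z in Metric.ball c' ρ', φ z ≤ ∫⁻ z, φ z := setLIntegral_le_lintegral _ _
      _ = ∫⁻ z in Metric.ball c ρ, φ z := by
          rw [← lintegral_indicator measurableSet_ball, ← e]
      _ ≤ _ := hT
      _ = volume (Metric.ball c' (2 ^ k / 2 * ρ)) * T := by
          rw [vol_ball_scale c' c (by positivity)]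
      _ ≤ _ := by gcongr

lemma geom_const {n k : ℕ} {s η : ℝ} :
    ENNReal.ofReal ((2 ^ k / 2) ^ n) ^ (-(1 / s)) * ENNReal.ofReal ((4 * 2 ^ k) ^ n) ^ η =
      ENNReal.ofReal (2 ^ (n / s + 2 * n * η)) * ENNReal.ofReal (2 ^ (n * (η - 1 / s))) ^ k := by
  have e1 : ((2 : ℝ) ^ k / 2) ^ n = 2 ^ (((k : ℝ) - 1) * n) := by
    rw [Real.rpow_mul (by norm_num), Real.rpow_sub (by norm_num), Real.rpow_one, Real.rpow_natCast,
      Real.rpow_natCast]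
  have e2 : ((4 : ℝ) * 2 ^ k) ^ n = 2 ^ (((k : ℝ) + 2) * n) := by
    rw [Real.rpow_mul (by norm_num), Real.rpow_add (by norm_num), Real.rpow_natCast,
      Real.rpow_natCast, mul_comm]
    norm_num
  rw [e1, e2, ENNReal.ofReal_rpow_of_pos (by positivity), ENNReal.ofReal_rpow_of_pos (by positivity),
    ← ENNReal.ofReal_pow (by positivity), ← ENNReal.ofReal_mul (by positivity),
    ← ENNReal.ofReal_mul (by positivity)]
  congr 1
  rw [← Real.rpow_mul (by norm_num), ← Real.rpow_mul (by norm_num), ← Real.rpow_natCast,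
    ← Real.rpow_mul (by norm_num), ← Real.rpow_add (by norm_num), ← Real.rpow_add (by norm_num)]
  congr 1
  ring

lemma dual_bound {n : ℕ} (hn : 1 ≤ n) {r r0 s r' : ℝ} (hr : 1 < r) (hrr : r ≤ r0)
    (hc : r.HolderConjugate r') (hs : 1 < s) (hsr : s < r') (hs0 : 1 - 1 / r0 < 1 / s) :
    ∃ C : ℝ≥0∞, C ≠ ⊤ ∧ ∀ (H φ : Eucl n → ℝ≥0∞) (m : ℝ≥0∞) (c : Eucl n) (ρ : ℝ), 0 < ρ →
      Measurable H → Measurable φ → MB r r0 m H → (∀ y, y ∉ Metric.ball c ρ → φ y = 0) →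
      ∫⁻ x, H x * HLM (fun y => φ y ^ s) x ^ (1 / s) ≤
        C * (m * volume (Metric.ball c ρ) ^ (1 / r - 1 / r0) * (∫⁻ x, φ x ^ r') ^ (1 / r')) := by
  have hr0 : 0 < r := by linarith
  have hs0' : 0 < s := by linarith
  have hr00 : 0 < r0 := by linarith
  have hr'0 : 0 < r' := by linarith
  have hσ : 0 ≤ 1 / r - 1 / r0 := by
    rw [sub_nonneg]; exact one_div_le_one_div_of_le hr0 hrr
  have hinv : 1 / r + 1 / r' = 1 := by
    have := hc.inv_add_inv_eq_one
    simpa [one_div] using this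
  have hη : 0 ≤ 1 - 1 / r0 := by
    have : 1 / r0 ≤ 1 := by rw [div_le_one hr00]; linarith
    linarith
  have hq : 1 < r' / s := by rwa [one_lt_div hs0']
  obtain ⟨Cs, hCs, hstr⟩ := HLM_strong hn hq
  set η := 1 - 1 / r0 with hηdef
  set γ : ℝ≥0∞ := ENNReal.ofReal (2 ^ (n * (η - 1 / s))) with hγ
  have hγ1 : γ < 1 := by
    rw [hγ, ← ENNReal.ofReal_one]
    refine (ENNReal.ofReal_lt_ofReal_iff one_pos).2 ?_
    refine Real.rpow_lt_one_of_one_lt_of_neg (by norm_num) ?_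
    have : (0 : ℝ) < n := by exact_mod_cast hn
    exact mul_neg_of_pos_of_neg this (by linarith)
  set A : ℝ≥0∞ := ENNReal.ofReal (2 ^ (n / s + 2 * n * η)) with hA
  refine ⟨ENNReal.ofReal (2 ^ n) ^ (1 / r - 1 / r0) * Cs ^ (1 / r') + A * (1 - γ)⁻¹, ?_, ?_⟩
  · refine ENNReal.add_ne_top.2 ⟨ENNReal.mul_ne_top ?_ ?_, ENNReal.mul_ne_top ENNReal.ofReal_ne_top ?_⟩
    · exact ENNReal.rpow_ne_top_of_nonneg hσ ENNReal.ofReal_ne_top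
    · exact ENNReal.rpow_ne_top_of_nonneg (by positivity) hCs
    · exact ENNReal.inv_ne_top.2 (tsub_pos_of_lt hγ1).ne'
  intro H φ m c ρ hρ hHm hφm hMB hsupp
  set V := volume (Metric.ball c ρ) with hV
  have hV0 : V ≠ 0 := vol_ball_ne_zero c hρ
  have hVt : V ≠ ⊤ := vol_ball_ne_top c ρ
  set P := (∫⁻ x, φ x ^ r') ^ (1 / r') with hP
  set Φ : Eucl n → ℝ≥0∞ := fun y => φ y ^ s with hΦ
  have hΦm : Measurable Φ := hφm.pow_const s
  set W : Eucl n → ℝ≥0∞ := fun x => HLM Φ x ^ (1 / s) with hW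
  have hWm : Measurable W := (HLM_measurable Φ).pow_const _
  have HB : ∀ c' ρ', 0 < ρ' → (∫⁻ y in Metric.ball c' ρ', H y ^ r) ^ (1 / r) ≤
      m * volume (Metric.ball c' ρ') ^ (1 / r - 1 / r0) := by
    intro c' ρ' hρ'
    have := ENNReal.rpow_le_rpow (hMB c' ρ' hρ') (by positivity : 0 ≤ 1 / r)
    rwa [← ENNReal.rpow_mul (m * _), mul_one_div_cancel hr0.ne', ENNReal.rpow_one] at this
  have near : ∫⁻ x in Metric.ball c (2 * ρ), H x * W x ≤
      ENNReal.ofReal (2 ^ n) ^ (1 / r - 1 / r0) * Cs ^ (1 / r') * (m * V ^ (1 / r - 1 / r0) * P) := by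
    refine (ENNReal.lintegral_mul_le_Lp_mul_Lq _ hc hHm.aemeasurable hWm.aemeasurable).trans ?_
    have h1 := HB c (2 * ρ) (by positivity)
    rw [vol_ball_scale c c (by norm_num), ENNReal.mul_rpow_of_nonneg _ _ hσ] at h1
    have h2 : (∫⁻ x in Metric.ball c (2 * ρ), W x ^ r') ^ (1 / r') ≤ Cs ^ (1 / r') * P := by
      rw [hP, ← ENNReal.mul_rpow_of_nonneg _ _ (by positivity)]
      refine ENNReal.rpow_le_rpow ?_ (by positivity)
      refine (setLIntegral_le_lintegral _ _).trans ?_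
      have e1 : ∀ x, W x ^ r' = HLM Φ x ^ (r' / s) := fun x => by
        rw [hW, ← ENNReal.rpow_mul]; congr 1; ring
      have e2 : ∀ x, φ x ^ r' = Φ x ^ (r' / s) := fun x => by
        rw [hΦ, ← ENNReal.rpow_mul, mul_div_cancel₀ _ hs0'.ne']
      simp only [e1, e2]
      exact hstr Φ hΦm
    refine (mul_le_mul' h1 h2).trans_eq ?_
    ring
  have far : ∀ k : ℕ, ∫⁻ x in Metric.ball c (4 * 2 ^ k * ρ) \ Metric.ball c (2 * 2 ^ k * ρ), H x * W x ≤
      A * (m * V ^ (1 / r - 1 / r0) * P) * γ ^ k := by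
    intro k
    set b := ENNReal.ofReal (((2 : ℝ) ^ k / 2) ^ n) with hb
    have hb0 : b ≠ 0 := by
      rw [hb, Ne, ENNReal.ofReal_eq_zero, not_le]; positivity
    have hbt : b ≠ ⊤ := ENNReal.ofReal_ne_top
    set τ := P * V ^ (-(1 / r')) * b ^ (-(1 / s)) with hτ
    have hWτ : ∀ x, x ∉ Metric.ball c (2 * 2 ^ k * ρ) → W x ≤ τ := by
      intro x hx
      have hsuppΦ : ∀ y, y ∉ Metric.ball c ρ → Φ y = 0 := by
        intro y hy
        rw [hΦ]
        simp only [hsupp y hy]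
        exact ENNReal.zero_rpow_of_pos hs0'
      have h1 : HLM Φ x ≤ τ ^ s := by
        refine HLM_supp hρ hsuppΦ k hx _ ?_
        calc ∫⁻ z in Metric.ball c ρ, Φ z
            ≤ (∫⁻ z in Metric.ball c ρ, φ z ^ r') ^ (s / r') * V ^ (1 - s / r') :=
              lint_pow_le volume hφm hs0' hsr.le _
          _ ≤ (∫⁻ z, φ z ^ r') ^ (s / r') * V ^ (1 - s / r') := by
              gcongr
              exact Measure.restrict_le_self
          _ = P ^ s * V ^ (1 - s / r') := by
              rw [hP, ← ENNReal.rpow_mul]; congr 2; ring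
          _ = b * V * τ ^ s := by
              rw [hτ, ENNReal.mul_rpow_of_nonneg _ _ hs0'.le, ENNReal.mul_rpow_of_nonneg _ _ hs0'.le,
                ← ENNReal.rpow_mul V, ← ENNReal.rpow_mul b,
                show -(1 / s) * s = -1 by field_simp, ENNReal.rpow_neg_one]
              have : V ^ (1 - s / r') = V * V ^ (-(1 / r') * s) := by
                nth_rewrite 2 [← ENNReal.rpow_one V]
                rw [← ENNReal.rpow_add _ _ hV0 hVt]
                congr 1; ring
              rw [this]
              calc _ = P ^ s * (V * V ^ (-(1 / r') * s)) * (b * b⁻¹) := by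
                    rw [ENNReal.mul_inv_cancel hb0 hbt, mul_one]
                _ = _ := by ring
      have h2 := ENNReal.rpow_le_rpow h1 (by positivity : 0 ≤ 1 / s)
      rwa [← ENNReal.rpow_mul τ, mul_one_div_cancel hs0'.ne', ENNReal.rpow_one] at h2
    have hDk : ∫⁻ x in Metric.ball c (4 * 2 ^ k * ρ), H x ≤
        m * (ENNReal.ofReal ((4 * 2 ^ k) ^ n) ^ η * V ^ η) := by
      have h1 := lint_pow_le volume hHm one_pos hr.le (Metric.ball c (4 * 2 ^ k * ρ))
      simp only [ENNReal.rpow_one] at h1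
      refine h1.trans ((mul_le_mul' (HB c _ (by positivity)) le_rfl).trans_eq ?_)
      rw [mul_assoc, ← ENNReal.rpow_add _ _ (vol_ball_ne_zero c (by positivity)) (vol_ball_ne_top c _),
        vol_ball_scale c c (by positivity), ← ENNReal.mul_rpow_of_nonneg _ _ hη]
      congr 2
      ring
    have hmeas : MeasurableSet (Metric.ball c (4 * 2 ^ k * ρ) \ Metric.ball c (2 * 2 ^ k * ρ)) :=
      measurableSet_ball.diff measurableSet_ball
    calc _ ≤ ∫⁻ x in Metric.ball c (4 * 2 ^ k * ρ) \ Metric.ball c (2 * 2 ^ k * ρ), H x * τ := by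
          refine setLIntegral_mono' hmeas fun x hx => ?_
          exact mul_le_mul' le_rfl (hWτ x hx.2)
      _ ≤ ∫⁻ x in Metric.ball c (4 * 2 ^ k * ρ), H x * τ := lintegral_mono_set Set.sdiff_subset
      _ = (∫⁻ x in Metric.ball c (4 * 2 ^ k * ρ), H x) * τ := lintegral_mul_const _ hHm
      _ ≤ m * (ENNReal.ofReal ((4 * 2 ^ k) ^ n) ^ η * V ^ η) * τ := by gcongr
      _ = m * (V ^ η * V ^ (-(1 / r'))) * P *
          (b ^ (-(1 / s)) * ENNReal.ofReal ((4 * 2 ^ k) ^ n) ^ η) := by rw [hτ]; ring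
      _ = _ := by
          rw [hb, geom_const, ← ENNReal.rpow_add _ _ hV0 hVt,
            show η + -(1 / r') = 1 / r - 1 / r0 by rw [hηdef]; linarith]
          ring
  calc ∫⁻ x, H x * W x ≤ ∫⁻ x in Metric.ball c (2 * ρ) ∪
      ⋃ k : ℕ, (Metric.ball c (4 * 2 ^ k * ρ) \ Metric.ball c (2 * 2 ^ k * ρ)), H x * W x := by
        rw [← setLIntegral_univ]
        exact lintegral_mono_set (univ_dyadic c hρ)
    _ ≤ (∫⁻ x in Metric.ball c (2 * ρ), H x * W x) +
        ∑' k : ℕ, ∫⁻ x in Metric.ball c (4 * 2 ^ k * ρ) \ Metric.ball c (2 * 2 ^ k * ρ), H x * W x :=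
        (lintegral_union_le _ _ _).trans (add_le_add le_rfl (lintegral_iUnion_le _ _))
    _ ≤ ENNReal.ofReal (2 ^ n) ^ (1 / r - 1 / r0) * Cs ^ (1 / r') * (m * V ^ (1 / r - 1 / r0) * P) +
        ∑' k : ℕ, A * (m * V ^ (1 / r - 1 / r0) * P) * γ ^ k :=
        add_le_add near (ENNReal.tsum_le_tsum far)
    _ = _ := by
        rw [ENNReal.tsum_mul_left, ENNReal.tsum_geometric]
        ring

lemma key_ineq {n : ℕ} {p : ℝ} (hp : 1 < p) {N : ℝ → ℝ} (hN : MonotoneOn N (Set.Ici 1))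
    {f g : Eucl n → ℝ} (hfg : memF n p N f g) {H W : Eucl n → ℝ≥0∞} (hHm : Measurable H)
    (hWm : Measurable W) (hH0 : ∀ᵐ x, 0 < H x ∧ H x < ⊤) (hW0 : ∀ᵐ x, 0 < W x ∧ W x < ⊤)
    (hg : ∀ᵐ x, (‖g x‖₊ : ℝ≥0∞) ≤ H x) {K : ℝ≥0∞} (hK : K ≠ ⊤)
    (hap : apConst n p (fun x => H x ^ (1 - p) * W x) ≤ K) :
    ∫⁻ x, (‖f x‖₊ : ℝ≥0∞) * W x ≤ ENNReal.ofReal (N K.toReal) * ∫⁻ x, H x * W x := by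
  obtain ⟨hfm, hgm, hF⟩ := hfg
  have hp0 : 0 < p := by linarith
  have hwt : IsWeight (fun x => H x ^ (1 - p) * W x) := by
    refine ⟨(hHm.pow_const _).mul hWm, ?_⟩
    filter_upwards [hH0, hW0] with x hx hy
    exact ⟨ENNReal.mul_pos (rpow_ne_zero' hx.1.ne' hx.2.ne _) hy.1.ne',
      ENNReal.mul_lt_top (rpow_ne_top' hx.1.ne' hx.2.ne _).lt_top hy.2⟩
  have h1 := one_le_ap hp hwt
  have hapt : apConst n p (fun x => H x ^ (1 - p) * W x) ≠ ⊤ := ne_top_of_le_ne_top hK hap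
  have hNN : N (apConst n p (fun x => H x ^ (1 - p) * W x)).toReal ≤ N K.toReal := by
    have e1 : 1 ≤ (apConst n p (fun x => H x ^ (1 - p) * W x)).toReal := by
      simpa using ENNReal.toReal_mono hapt h1
    have e2 := ENNReal.toReal_mono hK hap
    exact hN e1 (e1.trans e2) e2
  have h2 := (hF _ ⟨hwt, hapt.lt_top⟩).trans
    (mul_le_mul' (ENNReal.ofReal_le_ofReal hNN) le_rfl)
  unfold wLp wLpE at h2
  set w := fun x => H x ^ (1 - p) * W x with hw
  set J := ∫⁻ x, H x * W x with hJ
  have e3 : ∫⁻ x, (‖g x‖₊ : ℝ≥0∞) ^ p * w x ≤ J := by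
    refine lintegral_mono_ae ?_
    filter_upwards [hH0, hg] with x hx hgx
    calc (‖g x‖₊ : ℝ≥0∞) ^ p * w x ≤ H x ^ p * (H x ^ (1 - p) * W x) := by
          rw [hw]; gcongr
      _ = H x * W x := by
          rw [← mul_assoc, ← ENNReal.rpow_add _ _ hx.1.ne' hx.2.ne]
          simp
  have hfm' : Measurable fun x => (‖f x‖₊ : ℝ≥0∞) := hfm.nnnorm.coe_nnreal_ennreal
  have hq0 : 0 ≤ 1 - 1 / p := by
    rw [sub_nonneg, div_le_one hp0]; exact hp.le
  calc ∫⁻ x, (‖f x‖₊ : ℝ≥0∞) * W x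
      = ∫⁻ x, ((‖f x‖₊ : ℝ≥0∞) ^ p * w x) ^ (1 / p) * (H x * W x) ^ (1 - 1 / p) := by
        refine lintegral_congr_ae ?_
        filter_upwards [hH0, hW0] with x hx hy
        rw [hw]
        simp only
        rw [ENNReal.mul_rpow_of_nonneg _ _ (by positivity),
          ENNReal.mul_rpow_of_nonneg _ _ (by positivity),
          ENNReal.mul_rpow_of_nonneg _ _ hq0, ← ENNReal.rpow_mul, ← ENNReal.rpow_mul,
          mul_one_div_cancel hp0.ne', ENNReal.rpow_one]
        have a1 : H x ^ ((1 - p) * (1 / p)) * H x ^ (1 - 1 / p) = 1 := by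
          rw [← ENNReal.rpow_add _ _ hx.1.ne' hx.2.ne]
          have : (1 - p) * (1 / p) + (1 - 1 / p) = 0 := by field_simp; ring
          rw [this, ENNReal.rpow_zero]
        have a2 : W x ^ (1 / p) * W x ^ (1 - 1 / p) = W x := by
          rw [← ENNReal.rpow_add _ _ hy.1.ne' hy.2.ne]; simp
        calc (‖f x‖₊ : ℝ≥0∞) * W x = ‖f x‖₊ * 1 * W x := by rw [mul_one]
          _ = ‖f x‖₊ * (H x ^ ((1 - p) * (1 / p)) * H x ^ (1 - 1 / p)) *
              (W x ^ (1 / p) * W x ^ (1 - 1 / p)) := by rw [a1, a2]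
          _ = _ := by ring
    _ ≤ (∫⁻ x, (‖f x‖₊ : ℝ≥0∞) ^ p * w x) ^ (1 / p) * J ^ (1 - 1 / p) :=
        ENNReal.lintegral_mul_norm_pow_le
          ((hfm'.pow_const _).mul ((hHm.pow_const _).mul hWm)).aemeasurable
          (hHm.mul hWm).aemeasurable (by positivity) hq0 (by ring)
    _ ≤ (ENNReal.ofReal (N K.toReal) * J ^ (1 / p)) * J ^ (1 - 1 / p) := by
        refine mul_le_mul' (h2.trans ?_) le_rfl
        gcongr
    _ = ENNReal.ofReal (N K.toReal) * J := by
        rw [mul_assoc, ← ENNReal.rpow_add_of_nonneg _ _ (by positivity) hq0]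
        simp

lemma cancel_pow {r r' : ℝ} (hc : r.HolderConjugate r') {I A : ℝ≥0∞} (hI : I ≠ ⊤)
    (h : I ≤ A * I ^ (1 / r')) : I ≤ A ^ r := by
  by_cases h0 : I = 0
  · simp [h0]
  have hr0 : 0 < r := hc.pos
  have e : I ^ (1 / r) * I ^ (1 / r') = I := by
    rw [← ENNReal.rpow_add _ _ h0 hI, one_div, one_div, hc.inv_add_inv_eq_one, ENNReal.rpow_one]
  have h1 : I ^ (1 / r) ≤ A := by
    have : I ^ (1 / r) * I ^ (1 / r') ≤ A * I ^ (1 / r') := by rw [e]; exact h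
    exact (ENNReal.mul_le_mul_iff_left (rpow_ne_zero' h0 hI _) (rpow_ne_top' h0 hI _)).1 this
  calc I = (I ^ (1 / r)) ^ r := by
        rw [← ENNReal.rpow_mul, one_div_mul_cancel hr0.ne', ENNReal.rpow_one]
    _ ≤ A ^ r := ENNReal.rpow_le_rpow h1 hr0.le

lemma mct_min {n : ℕ} {r : ℝ} (hr : 0 < r) {F : Eucl n → ℝ≥0∞} (hF : Measurable F)
    (S : Set (Eucl n)) {A : ℝ≥0∞} (h : ∀ k : ℕ, ∫⁻ y in S, min (F y) k ^ r ≤ A) :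
    ∫⁻ y in S, F y ^ r ≤ A := by
  have h1 : Tendsto (fun k : ℕ => ∫⁻ y in S, min (F y) k ^ r) atTop
      (𝓝 (∫⁻ y in S, F y ^ r)) := by
    refine lintegral_tendsto_of_tendsto_of_monotone
      (fun k => ((hF.min measurable_const).pow_const _).aemeasurable) ?_ ?_
    · refine Eventually.of_forall fun y i j hij => ?_
      simp only
      gcongr
    · refine Eventually.of_forall fun y => ?_
      refine (ENNReal.continuous_rpow_const.tendsto _).comp ?_
      have := (tendsto_const_nhds (x := F y)).min ENNReal.tendsto_nat_nhds_top
      simpa using this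
  exact le_of_tendsto' h1 h

lemma ae_of_balls {n : ℕ} {P : Eucl n → Prop}
    (h : ∀ k : ℕ, ∀ᵐ x ∂(volume.restrict (Metric.ball (0 : Eucl n) (k + 1))), P x) :
    ∀ᵐ x, P x := by
  have h1 : ∀ k : ℕ, ∀ᵐ x : Eucl n, x ∈ Metric.ball (0 : Eucl n) (k + 1) → P x :=
    fun k => (ae_restrict_iff' measurableSet_ball).1 (h k)
  filter_upwards [ae_all_iff.2 h1] with x hx
  obtain ⟨k, hk⟩ := exists_nat_gt (dist x 0)
  exact hx k (Metric.mem_ball.2 (by linarith))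

lemma MB_ae_lt_top {n : ℕ} {r r0 : ℝ} (hr : 1 < r) {m : ℝ≥0∞} (hm : m ≠ ⊤)
    {H : Eucl n → ℝ≥0∞} (hHm : Measurable H) (h : MB r r0 m H) : ∀ᵐ x, H x < ⊤ := by
  refine ae_of_balls fun k => ?_
  have hk : (0 : ℝ) < k + 1 := by positivity
  have h1 : ∫⁻ y in Metric.ball (0 : Eucl n) (k + 1), H y ^ r ≠ ⊤ := by
    refine ne_top_of_le_ne_top ?_ (h 0 (k + 1) hk)
    refine ENNReal.rpow_ne_top_of_nonneg (by linarith) (ENNReal.mul_ne_top hm ?_)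
    exact rpow_ne_top' (vol_ball_ne_zero _ hk) (vol_ball_ne_top _ _) _
  filter_upwards [ae_lt_top (hHm.pow_const _) h1] with x hx
  by_contra hcon
  rw [not_lt, top_le_iff] at hcon
  rw [hcon, ENNReal.top_rpow_of_pos (by linarith)] at hx
  exact lt_irrefl _ hx

lemma MB_zero_ae {n : ℕ} {r r0 : ℝ} (hr : 1 < r)
    {H : Eucl n → ℝ≥0∞} (hHm : Measurable H) (h : MB r r0 0 H) : ∀ᵐ x, H x = 0 := by
  refine ae_of_balls fun k => ?_
  have hk : (0 : ℝ) < k + 1 := by positivity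
  have h1 : ∫⁻ y in Metric.ball (0 : Eucl n) (k + 1), H y ^ r = 0 := by
    have := h 0 (k + 1) hk
    rw [zero_mul, ENNReal.zero_rpow_of_pos (by linarith)] at this
    exact le_antisymm this zero_le
  filter_upwards [(lintegral_eq_zero_iff (hHm.pow_const _)).1 h1] with x hx
  simp only [Pi.zero_apply, ENNReal.rpow_eq_zero_iff] at hx
  rcases hx with hx | hx
  · exact hx.1
  · linarith [hx.2]

lemma morrey_of_ae_zero {n : ℕ} {r r0 : ℝ} (hr : 1 < r) {F : Eucl n → ℝ≥0∞}
    (h : ∀ᵐ x, F x = 0) : morreyE n r r0 F = 0 := by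
  unfold morreyE
  simp only [ENNReal.iSup_eq_zero]
  intro x R _
  have : ∫⁻ y in Metric.ball x R, F y ^ r = 0 := by
    rw [lintegral_congr_ae (g := fun _ => 0)]
    · simp
    · filter_upwards [ae_restrict_of_ae h] with y hy
      rw [hy, ENNReal.zero_rpow_of_pos (by linarith)]
  rw [this, ENNReal.zero_rpow_of_pos (by positivity), mul_zero]

lemma f_zero {n : ℕ} {p : ℝ} (hp : 1 < p) {N : ℝ → ℝ} {f g : Eucl n → ℝ}
    (hfg : memF n p N f g) (hg : ∀ᵐ x, (‖g x‖₊ : ℝ≥0∞) = 0) :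
    ∀ᵐ x, (‖f x‖₊ : ℝ≥0∞) = 0 := by
  obtain ⟨hfm, hgm, hF⟩ := hfg
  have h2 := hF _ (memAp_one p)
  unfold wLp wLpE at h2
  have hp0 : 0 < p := by linarith
  have : ∫⁻ x, (‖g x‖₊ : ℝ≥0∞) ^ p * 1 = 0 := by
    rw [lintegral_congr_ae (g := fun _ => 0)]
    · simp
    · filter_upwards [hg] with y hy
      rw [hy, ENNReal.zero_rpow_of_pos (by linarith), zero_mul]
  rw [this, ENNReal.zero_rpow_of_pos (by positivity), mul_zero] at h2
  have h3 := le_antisymm h2 zero_le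
  rw [ENNReal.rpow_eq_zero_iff] at h3
  have h4 : ∫⁻ x, (‖f x‖₊ : ℝ≥0∞) ^ p * 1 = 0 := by
    rcases h3 with h3 | h3
    · exact h3.1
    · exact absurd h3.2 (by have : 0 < 1 / p := by positivity
                            linarith)
  simp only [mul_one] at h4
  filter_upwards [(lintegral_eq_zero_iff (hfm.nnnorm.coe_nnreal_ennreal.pow_const _)).1 h4] with x hx
  simp only [Pi.zero_apply, ENNReal.rpow_eq_zero_iff] at hx
  rcases hx with hx | hx
  · exact hx.1
  · linarith [hx.2]

/-- **Extrapolation in Morrey spaces `M^{r₀}_r`, `1 < r ≤ r₀ < ∞`.** -/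
theorem extrapolation_morrey (n : ℕ) (hn : 1 ≤ n) (r r0 : ℝ)
    (hr : 1 < r) (hrr : r ≤ r0)
    (p : ℝ) (hp : 1 < p)
    (N : ℝ → ℝ) (hN : MonotoneOn N (Set.Ici 1)) (hNpos : ∀ t, 1 ≤ t → 0 < N t) :
    ∃ C : ℝ, 0 < C ∧ ∀ f g : Eucl n → ℝ, memF n p N f g →
      morreyNorm n r r0 f ≤ ENNReal.ofReal C * morreyNorm n r r0 g := by
  have hr0 : 0 < r := by linarith
  have hr00 : 0 < r0 := by linarith
  obtain ⟨t, ht, htr⟩ := exists_between hr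
  have ht0 : 0 < t := by linarith
  set r' := r.conjExponent with hr'
  have hc : r.HolderConjugate r' := Real.HolderConjugate.conjExponent hr
  have hr'0 : 0 < r' := hc.symm.pos
  have hir : 1 / r0 ≤ 1 / r := one_div_le_one_div_of_le hr0 hrr
  have hir0 : 0 < 1 / r0 := by positivity
  have hir1 : 1 / r < 1 := by rw [div_lt_one hr0]; exact hr
  obtain ⟨u, hu, hu1⟩ := exists_between (show 1 - 1 / r0 < 1 by linarith)
  have hu0 : 0 < u := by linarith
  obtain ⟨s, hs, hsu⟩ : ∃ s : ℝ, 1 < s ∧ 1 / s = u :=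
    ⟨1 / u, by rw [lt_div_iff₀ hu0]; linarith, by simp⟩
  have hs0 : 0 < s := by linarith
  have hirr : 1 / r + 1 / r' = 1 := by
    rw [one_div, one_div]; exact hc.inv_add_inv_eq_one
  have hsr : s < r' := by
    have : 1 / r' < 1 / s := by linarith
    exact (one_div_lt_one_div hr'0 hs0).1 this
  obtain ⟨K, hK, hKA⟩ := HLM_A1 hn (δ := 1 / t) (by positivity) (by rw [div_lt_one ht0]; exact ht)
  obtain ⟨L, hL, hLA⟩ := HLM_A1 hn (δ := 1 / s) (by positivity) (by rw [div_lt_one hs0]; exact hs)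
  obtain ⟨C1, hC1, hC1M⟩ := MB_HLM hn hrr ht htr
  obtain ⟨C2, hC2, hC2D⟩ := dual_bound hn hr hrr hc hs hsr (by linarith : 1 - 1 / r0 < 1 / s)
  set A := (K * ENNReal.ofReal ((n + 1 : ℝ) ^ n)) ^ (p - 1) *
    (L * ENNReal.ofReal ((n + 1 : ℝ) ^ n)) with hA
  have hAt : A ≠ ⊤ := ENNReal.mul_ne_top
    (ENNReal.rpow_ne_top_of_nonneg (by linarith) (ENNReal.mul_ne_top hK ENNReal.ofReal_ne_top))
    (ENNReal.mul_ne_top hL ENNReal.ofReal_ne_top)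
  set D := ENNReal.ofReal (N A.toReal) * (C2 * C1) with hD
  have hDt : D ≠ ⊤ := ENNReal.mul_ne_top ENNReal.ofReal_ne_top (ENNReal.mul_ne_top hC2 hC1)
  have hDle : D ≤ ENNReal.ofReal (D.toReal + 1) := by
    conv_lhs => rw [← ENNReal.ofReal_toReal hDt]
    exact ENNReal.ofReal_le_ofReal (by linarith)
  have hDpos : 0 < D.toReal + 1 := by positivity
  refine ⟨D.toReal + 1, hDpos, ?_⟩
  intro f g hfg
  unfold morreyNorm
  set F := fun x => (‖f x‖₊ : ℝ≥0∞) with hFdef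
  set G := fun x => (‖g x‖₊ : ℝ≥0∞) with hGdef
  have hFm : Measurable F := hfg.1.nnnorm.coe_nnreal_ennreal
  have hGm : Measurable G := hfg.2.1.nnnorm.coe_nnreal_ennreal
  set m := morreyE n r r0 G with hm
  have hMB : MB r r0 m G := morrey_MB hr G
  by_cases hmt : m = ⊤
  · rw [hmt, ENNReal.mul_top (by simpa using hDpos)]
    exact le_top
  by_cases hGz : ∀ᵐ x, G x = 0
  · rw [morrey_of_ae_zero hr (f_zero hp hfg hGz)]
    exact zero_le
  set H := fun x => HLM (fun y => G y ^ t) x ^ (1 / t) with hH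
  have hHm : Measurable H := (HLM_measurable _).pow_const _
  have hHMB : MB r r0 (C1 * m) H := hC1M G m hGm hMB
  have hHt := MB_ae_lt_top hr (ENNReal.mul_ne_top hC1 hmt) hHm hHMB
  have hGt : ∫⁻ y, G y ^ t ≠ 0 := by
    intro h0
    apply hGz
    filter_upwards [(lintegral_eq_zero_iff (hGm.pow_const _)).1 h0] with x hx
    simp only [Pi.zero_apply, ENNReal.rpow_eq_zero_iff] at hx
    rcases hx with hx | hx
    · exact hx.1
    · linarith [hx.2]
  have hH0 : ∀ᵐ x, 0 < H x ∧ H x < ⊤ := by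
    filter_upwards [hHt] with x hx
    refine ⟨?_, hx⟩
    rw [pos_iff_ne_zero]
    intro h0
    simp only [hH, ENNReal.rpow_eq_zero_iff] at h0
    rcases h0 with h0 | h0
    · exact (HLM_pos hGt x).ne' h0.1
    · have : 0 < 1 / t := by positivity
      linarith [h0.2]
  have hGH : ∀ᵐ x, G x ≤ H x := by
    filter_upwards [le_HLM_ae (hGm.pow_const t)] with x hx
    have := ENNReal.rpow_le_rpow hx (by positivity : 0 ≤ 1 / t)
    rwa [← ENNReal.rpow_mul, mul_one_div_cancel ht0.ne', ENNReal.rpow_one] at this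
  refine iSup_le fun x0 => iSup_le fun R => iSup_le fun hR => ?_
  set V := volume (Metric.ball x0 R) with hV
  have hV0 : V ≠ 0 := vol_ball_ne_zero x0 hR
  have hVt : V ≠ ⊤ := vol_ball_ne_top x0 R
  have main : ∫⁻ y in Metric.ball x0 R, F y ^ r ≤ (D * m * V ^ (1 / r - 1 / r0)) ^ r := by
    refine mct_min hr0 hFm _ fun k => ?_
    set I := ∫⁻ y in Metric.ball x0 R, min (F y) k ^ r with hI
    have hIt : I ≠ ⊤ := by
      have : I ≤ ∫⁻ y in Metric.ball x0 R, (k : ℝ≥0∞) ^ r := by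
        refine lintegral_mono fun y => ?_
        exact ENNReal.rpow_le_rpow (min_le_right _ _) hr0.le
      refine ne_top_of_le_ne_top ?_ this
      rw [setLIntegral_const]
      exact ENNReal.mul_ne_top (ENNReal.rpow_ne_top_of_nonneg hr0.le (by simp)) hVt
    refine cancel_pow hc hIt ?_
    set φ := (Metric.ball x0 R).indicator (fun y => min (F y) (k : ℝ≥0∞) ^ (r - 1)) with hφ
    have hφm : Measurable φ :=
      ((hFm.min measurable_const).pow_const _).indicator measurableSet_ball
    have hsupp : ∀ y, y ∉ Metric.ball x0 R → φ y = 0 := fun y hy => Set.indicator_of_notMem hy _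
    have hφI : ∫⁻ x, φ x ^ r' = I := by
      rw [hI, ← lintegral_indicator measurableSet_ball]
      refine lintegral_congr fun y => ?_
      by_cases hy : y ∈ Metric.ball x0 R
      · rw [hφ, Set.indicator_of_mem hy, Set.indicator_of_mem hy, ← ENNReal.rpow_mul,
          hc.sub_one_mul_conj]
      · rw [hφ, Set.indicator_of_notMem hy, Set.indicator_of_notMem hy,
          ENNReal.zero_rpow_of_pos hr'0]
    by_cases hφz : ∫⁻ y, φ y ^ s = 0
    · have : I = 0 := by
        rw [← hφI, lintegral_congr_ae (g := fun _ => 0)]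
        · simp
        · filter_upwards [(lintegral_eq_zero_iff (hφm.pow_const _)).1 hφz] with x hx
          simp only [Pi.zero_apply, ENNReal.rpow_eq_zero_iff] at hx
          rcases hx with hx | hx
          · rw [hx.1, ENNReal.zero_rpow_of_pos hr'0]
          · linarith [hx.2]
      rw [this]; exact zero_le
    set W := fun x => HLM (fun y => φ y ^ s) x ^ (1 / s) with hW
    have hWm : Measurable W := (HLM_measurable _).pow_const _
    have his : 0 < 1 / s := by positivity
    have hW0 : ∀ᵐ x, 0 < W x ∧ W x < ⊤ := by
      refine Eventually.of_forall fun x => ⟨?_, ?_⟩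
      · rw [pos_iff_ne_zero]
        intro h0
        simp only [hW, ENNReal.rpow_eq_zero_iff] at h0
        rcases h0 with h0 | h0
        · exact (HLM_pos hφz x).ne' h0.1
        · linarith [h0.2]
      · refine (ENNReal.rpow_ne_top_of_nonneg his.le ?_).lt_top
        refine ne_top_of_le_ne_top ?_
          (HLM_const_le (((k : ℝ≥0∞) ^ (r - 1)) ^ s) (fun y => ?_) x)
        · exact ENNReal.rpow_ne_top_of_nonneg hs0.le
            (ENNReal.rpow_ne_top_of_nonneg (by linarith) (by simp))
        · refine ENNReal.rpow_le_rpow ?_ hs0.le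
          by_cases hy : y ∈ Metric.ball x0 R
          · rw [hφ, Set.indicator_of_mem hy]
            exact ENNReal.rpow_le_rpow (min_le_right _ _) (by linarith)
          · rw [hsupp y hy]; exact zero_le
    have hφW : ∀ᵐ x, φ x ≤ W x := by
      filter_upwards [le_HLM_ae (hφm.pow_const s)] with x hx
      have := ENNReal.rpow_le_rpow hx his.le
      rwa [← ENNReal.rpow_mul, mul_one_div_cancel hs0.ne', ENNReal.rpow_one] at this
    have hap := ap_bound hp hL hK hHm hWm (hKA _ (hGm.pow_const t)) (hLA _ (hφm.pow_const s)) hH0 hW0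
    have hkey := key_ineq hp hN hfg hHm hWm hH0 hW0 hGH hAt hap
    have hdual := hC2D H φ (C1 * m) x0 R hR hHm hφm hHMB hsupp
    rw [hφI] at hdual
    calc I ≤ ∫⁻ x, F x * φ x := by
          rw [hI, ← lintegral_indicator measurableSet_ball]
          refine lintegral_mono fun y => ?_
          by_cases hy : y ∈ Metric.ball x0 R
          · rw [hφ, Set.indicator_of_mem hy, Set.indicator_of_mem hy]
            calc min (F y) (k : ℝ≥0∞) ^ r = min (F y) (k : ℝ≥0∞) ^ (1 + (r - 1)) := by
                  congr 1; ring
              _ = min (F y) (k : ℝ≥0∞) * min (F y) (k : ℝ≥0∞) ^ (r - 1) := by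
                  rw [ENNReal.rpow_add_of_nonneg _ _ zero_le_one (by linarith), ENNReal.rpow_one]
              _ ≤ _ := by gcongr; exact min_le_left _ _
          · rw [Set.indicator_of_notMem hy]; exact zero_le
      _ ≤ ∫⁻ x, F x * W x := by
          refine lintegral_mono_ae ?_
          filter_upwards [hφW] with x hx
          gcongr
      _ ≤ ENNReal.ofReal (N A.toReal) * ∫⁻ x, H x * W x := hkey
      _ ≤ ENNReal.ofReal (N A.toReal) * (C2 * (C1 * m * V ^ (1 / r - 1 / r0) * I ^ (1 / r'))) :=
          mul_le_mul' le_rfl hdual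
      _ = D * m * V ^ (1 / r - 1 / r0) * I ^ (1 / r') := by rw [hD]; ring
  have h1 := ENNReal.rpow_le_rpow main (by positivity : 0 ≤ 1 / r)
  rw [← ENNReal.rpow_mul, mul_one_div_cancel hr0.ne', ENNReal.rpow_one] at h1
  calc V ^ (1 / r0 - 1 / r) * (∫⁻ y in Metric.ball x0 R, F y ^ r) ^ (1 / r)
      ≤ V ^ (1 / r0 - 1 / r) * (D * m * V ^ (1 / r - 1 / r0)) := mul_le_mul' le_rfl h1
    _ = D * m * (V ^ (1 / r0 - 1 / r) * V ^ (1 / r - 1 / r0)) := by ring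
    _ = D * m := by
        rw [← ENNReal.rpow_add _ _ hV0 hVt]; simp
    _ ≤ ENNReal.ofReal (D.toReal + 1) * m := mul_le_mul' hDle le_rfl
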